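/- arXiv:2408.09684 — 2 statements merged into one kernel-verified Lean document; each statement's English description precedes it below -/
import Mathlib

section
/- Let G be an oriented indifference graph with a fixed oriented perfect elimination ordering, let (h_u)_{u∈V} be a Hamiltonian compatible with G, let χ be a simplicial mode, let ε_k be a single-particle energy, and let N_k be a nonzero complex constant. Then for all p ∈ ℤ, T_G^p(ε_k^{−1}) · ψ_{p,k} = (1−ω) · ε_k · ψ_{p,k} · (∂T_G^p(ε^{−1})/∂ε)|_{ε=ε_k}. -/
noncomputable section
open scoped Classical

/-- `ω = exp(2πi/d)`, the primitive `d`-th root of unity. -/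
def omegaD (d : ℕ) : ℂ := Complex.exp (2 * Real.pi * Complex.I / d)

/-- A finite set of vertices is independent if its elements are pairwise non-adjacent. -/
def IsIndep {V : Type*} (G : SimpleGraph V) (S : Finset V) : Prop :=
  ∀ u ∈ S, ∀ w ∈ S, u ≠ w → ¬ G.Adj u w

/-- The independence number `α` of the induced subgraph of `G` on the vertex set `A`. -/
def indepNum {V : Type*} (G : SimpleGraph V) (A : Finset V) : ℕ :=
  (A.powerset.filter (fun S => IsIndep G S)).sup Finset.card

/-- The ordered product `∏_{v ∈ S} h v` (in increasing order of vertices). -/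
def hProd {V : Type*} [LinearOrder V] {N : ℕ} (h : V → Matrix (Fin N) (Fin N) ℂ)
    (S : Finset V) : Matrix (Fin N) (Fin N) ℂ :=
  ((S.sort (· ≤ ·)).map h).prod

/-- The independent set charge `Q^{(i)}` of the induced subgraph on `A`. -/
def chargeQ {V : Type*} [LinearOrder V] {N : ℕ} (G : SimpleGraph V)
    (h : V → Matrix (Fin N) (Fin N) ℂ) (A : Finset V) (i : ℕ) :
    Matrix (Fin N) (Fin N) ℂ :=
  ∑ S ∈ A.powerset.filter (fun S => IsIndep G S ∧ S.card = i), hProd h S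

/-- The transfer operator `T(x) = ∑_{k=0}^{α} (−x)^k Q^{(k)}` of the induced subgraph on `A`. -/
def transferT {V : Type*} [LinearOrder V] {N : ℕ} (G : SimpleGraph V)
    (h : V → Matrix (Fin N) (Fin N) ℂ) (A : Finset V) (x : ℂ) :
    Matrix (Fin N) (Fin N) ℂ :=
  ∑ k ∈ Finset.range (indepNum G A + 1), (-x) ^ k • chargeQ G h A k
/-- An induced path `p 0, p 1, …, p n` in `G`: the vertices are distinct and two of them
are adjacent if and only if they are consecutive. -/
def IsInducedPath {V : Type*} (G : SimpleGraph V) {n : ℕ} (p : Fin (n + 1) → V) : Prop :=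
  Function.Injective p ∧
    ∀ i j : Fin (n + 1), G.Adj (p i) (p j) ↔ ((i : ℕ) + 1 = (j : ℕ) ∨ (j : ℕ) + 1 = (i : ℕ))

/-- A path is a dipath if all of its edges are oriented consistently from one end to the other. -/
def IsDipath {V : Type*} (dir : V → V → Prop) {n : ℕ} (p : Fin (n + 1) → V) : Prop :=
  (∀ i : Fin n, dir (p i.castSucc) (p i.succ)) ∨ (∀ i : Fin n, dir (p i.succ) (p i.castSucc))

/-- An oriented graph is dipath oriented if every induced path is a dipath. -/
def DipathOriented {V : Type*} (G : SimpleGraph V) (dir : V → V → Prop) : Prop :=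
  ∀ (n : ℕ) (p : Fin (n + 1) → V), IsInducedPath G p → IsDipath dir p
/-- The independence polynomial `Z(x) = ∑_{I independent} ∏_{u ∈ I} x·w u`
of the induced subgraph on `A`, with vertex weights `w`. -/
def indepPoly {V : Type*} (G : SimpleGraph V) (w : V → ℂ) (A : Finset V) (x : ℂ) : ℂ :=
  ∑ S ∈ A.powerset.filter (fun S => IsIndep G S), ∏ u ∈ S, (x * w u)
/-- `f` is an oriented perfect elimination ordering of the oriented graph `(G, dir)`:
it is an injective labelling of the vertices such that for every vertex the earlier
neighbours form a clique, and every directed edge points forwards. -/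
def IsOPEO {V : Type*} (G : SimpleGraph V) (dir : V → V → Prop) (f : V → ℕ) : Prop :=
  Function.Injective f ∧
    (∀ v u w, G.Adj u v → G.Adj w v → f u < f v → f w < f v → u ≠ w → G.Adj u w) ∧
    (∀ u w, dir u w → f u < f w)
/-- `T^{≻p}(u) = ∏_{m=1}^{d−1} T(u·ω^{−p−m})`, factors in increasing order of `m`. -/
def transferTsucc {V : Type*} [LinearOrder V] {N : ℕ} (d : ℕ) (G : SimpleGraph V)
    (h : V → Matrix (Fin N) (Fin N) ℂ) (A : Finset V) (p : ℤ) (u : ℂ) :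
    Matrix (Fin N) (Fin N) ℂ :=
  ((List.range (d - 1)).map (fun m => transferT G h A (u * omegaD d ^ (-(p + (m : ℤ) + 1))))).prod

/-- The parafermionic mode `ψ_{p,k} = (1/N_k) T^p(ε_k⁻¹) χ T^{≻p}(ε_k⁻¹)`. -/
def paraMode {V : Type*} [Fintype V] [LinearOrder V] {N : ℕ} (d : ℕ) (G : SimpleGraph V)
    (h : V → Matrix (Fin N) (Fin N) ℂ) (χ : Matrix (Fin N) (Fin N) ℂ)
    (ε Nk : ℂ) (p : ℤ) : Matrix (Fin N) (Fin N) ℂ :=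
  Nk⁻¹ • (transferT G h Finset.univ (ε⁻¹ * omegaD d ^ (-p)) * χ *
    transferTsucc d G h Finset.univ p ε⁻¹)
/-- The entrywise derivative at `ε` of `ε ↦ T^p(ε⁻¹)`,
explicitly `−∑_{j=0}^{α} j·(−ω^{−p})^j·ε^{−j−1}·Q^{(j)}`. -/
def transferTderiv {V : Type*} [Fintype V] [LinearOrder V] {N : ℕ} (d : ℕ) (G : SimpleGraph V)
    (h : V → Matrix (Fin N) (Fin N) ℂ) (p : ℤ) (ε : ℂ) : Matrix (Fin N) (Fin N) ℂ :=
  -∑ j ∈ Finset.range (indepNum G Finset.univ + 1),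
      ((j : ℂ) * (-(omegaD d ^ (-p))) ^ j * ε ^ (-(j : ℤ) - 1)) • chargeQ G h Finset.univ j
set_option linter.unusedSimpArgs false
section Abstract
variable {M : Type*} [Ring M] [Algebra ℂ M]

lemma abs_i (w : ℂ) (g Bx Bu Dx Du : M)
    (hBx : Bx * g = w • (g * Bx) + (1 - w) • (g * Dx))
    (hBu : Bu * g = w • (g * Bu) + (1 - w) • (g * Du))
    (hDD : Dx * Du = Du * Dx)
    (hsym : Bx * Du - Du * Bx = Bu * Dx - Dx * Bu) :
    w • (g * Dx * Bu) - Bu * (g * Dx) = w • (g * Du * Bx) - Bx * (g * Du) := by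
  have e1 := congrArg (· * Dx) hBu
  have e2 := congrArg (· * Du) hBx
  have e3 := congrArg (g * ·) hDD
  have e4 := congrArg (g * ·) hsym
  simp only [mul_add, add_mul, mul_sub, sub_mul, smul_mul_assoc, mul_smul_comm, mul_assoc] at *
  linear_combination (norm := module) (-1 : ℂ) • e1 + e2 + (1 - w) • e3 + w • e4

lemma abs_ii (x u : ℂ) (g Bx Bu Dx Du : M)
    (hDx : Dx * g = g * Dx) (hDu : Du * g = g * Du)
    (hDD : Dx * Du = Du * Dx) (hBB : Bx * Bu = Bu * Bx)
    (hT : (Bx - x • (g * Dx)) * (Bu - u • (g * Du)) = (Bu - u • (g * Du)) * (Bx - x • (g * Dx))) :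
    x • (g * Dx * Bu - Bu * (g * Dx)) = u • (g * Du * Bx - Bx * (g * Du)) := by
  have e1 := congrArg (g * · * Du) hDx
  have e2 := congrArg (g * · * Dx) hDu
  have e3 := congrArg (g * g * ·) hDD
  simp only [mul_sub, sub_mul, smul_mul_assoc, mul_smul_comm, mul_assoc] at *
  linear_combination (norm := module) (-1 : ℂ) • hT + hBB + (x * u) • e1 - (x * u) • e2 + (x * u) • e3

lemma abs_comm (w x u : ℂ) (h Ax Au Bx Bu Cx Cu : M)
    (hAx : Ax * h = w • (h * Ax) + (1 - w) • (h * Bx))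
    (hAu : Au * h = w • (h * Au) + (1 - w) • (h * Bu))
    (hBx : Bx * h = h * Bx) (hBu : Bu * h = h * Bu)
    (hAA : Ax * Au = Au * Ax) (hBB : Bx * Bu = Bu * Bx)
    (hCx : Ax = Bx + Cx) (hCu : Au = Bu + Cu)
    (hC : u • (w • (Cx * Bu) - Bu * Cx) = x • (w • (Cu * Bx) - Bx * Cu)) :
    (Ax - x • (h * Bx)) * (Au - u • (h * Bu)) = (Au - u • (h * Bu)) * (Ax - x • (h * Bx)) := by
  obtain rfl : Cx = Ax - Bx := by rw [hCx]; abel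
  obtain rfl : Cu = Au - Bu := by rw [hCu]; abel
  have e1 := congrArg (h * · * Bu) hBx
  have e2 := congrArg (h * · * Bx) hBu
  have e3 := congrArg (h * h * ·) hBB
  have e4 := congrArg (h * ·) hC
  have e5 := congrArg (· * Bu) hAx
  have e6 := congrArg (· * Bx) hAu
  have e7 := congrArg (h * ·) hBB
  clear hCx hCu hAx hAu hC
  simp only [mul_add, add_mul, mul_sub, sub_mul, smul_mul_assoc, mul_smul_comm, mul_assoc, smul_sub] at *
  linear_combination (norm := module) hAA + (x * u) • e1 - (x * u) • e2 + (x * u) • e3 - e4 - u • e5 + x • e6 - (u + x) • e7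

lemma abs_star (w s x u : ℂ) (h Ax Au Bx Bu : M)
    (hAx : Ax * h = w • (h * Ax) + (1 - w) • (h * Bx))
    (hAu : Au * h = w • (h * Au) + (1 - w) • (h * Bu))
    (hBx : Bx * h = h * Bx) (hBu : Bu * h = h * Bu)
    (hAA : Ax * Au = Au * Ax) (hBB : Bx * Bu = Bu * Bx)
    (hsym : Ax * Bu - Bu * Ax = Au * Bx - Bx * Au) :
    (x - u) • ((Ax - (w * s * x) • (h * Bx)) * (Au - (w * s * u) • (h * Bu)))
    - (x - w * u) • ((Ax - (w * s * x) • (h * Bx)) * (Au - (s * u) • (h * Bu)))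
    + (u - w * x) • ((Au - (w * s * u) • (h * Bu)) * (Ax - (s * x) • (h * Bx)))
    + (w * (x - u)) • ((Au - (s * u) • (h * Bu)) * (Ax - (s * x) • (h * Bx))) = 0 := by
  have e1 := congrArg (h * · * Bu) hBx
  have e2 := congrArg (h * · * Bx) hBu
  have e3 := congrArg (h * h * ·) hBB
  have e4 := congrArg (h * ·) hsym
  have e5 := congrArg (· * Bu) hAx
  have e6 := congrArg (· * Bx) hAu
  have e7 := congrArg (h * ·) hBB
  clear hAx hAu hsym
  simp only [mul_add, add_mul, mul_sub, sub_mul, smul_mul_assoc, mul_smul_comm, mul_assoc, smul_sub] at *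
  linear_combination (norm := module) (s * u * x * (1 - w)) • e5 - (s * u * x * (1 - w)) • e6 + (s * u * x * (1 - w) * (1 - w)) • e7 + (w * (s * u * x * (1 - w))) • e4 - ((1 - w) * u) • hAA - (s ^ 2 * x ^ 2 * u * w * (1 - w)) • (e1 - e2 + e3)
end Abstract
set_option linter.unusedSectionVars false
section Abstract2
variable {M : Type*} [Ring M] [Algebra ℂ M]

lemma abs_comm_scale (s x u : ℂ) (h Ax Au Bx Bu : M)
    (hBx : Bx * h = h * Bx) (hBu : Bu * h = h * Bu)
    (hAA : Ax * Au = Au * Ax) (hBB : Bx * Bu = Bu * Bx)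
    (hT : (Ax - x • (h * Bx)) * (Au - u • (h * Bu)) = (Au - u • (h * Bu)) * (Ax - x • (h * Bx))) :
    (Ax - (s * x) • (h * Bx)) * (Au - (s * u) • (h * Bu))
      = (Au - (s * u) • (h * Bu)) * (Ax - (s * x) • (h * Bx)) := by
  have e1 := congrArg (h * · * Bu) hBx
  have e2 := congrArg (h * · * Bx) hBu
  have e3 := congrArg (h * h * ·) hBB
  simp only [mul_sub, sub_mul, smul_mul_assoc, mul_smul_comm, mul_assoc, smul_sub] at *
  linear_combination (norm := module) s • hT + (1 - s) • hAA
    + ((s ^ 2 - s) * x * u) • (e1 - e2 + e3)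

/-- Ordered product `T i * T (i+1) * ... * T (i+k-1)`. -/
def pr (T : ℕ → M) : ℕ → ℕ → M
  | _, 0 => 1
  | i, k + 1 => T i * pr T (i + 1) k

lemma pr_rec (w : ℂ) (T τ : ℕ → M)
    (H : ∀ m, T m * T (m + 1) = (1 + w) • (T m * τ (m + 1)) - w • (τ m * τ (m + 1)))
    (k : ℕ) : ∀ i, pr T i (k + 1) =
      (∑ j ∈ Finset.range (k + 1), w ^ j) • (T i * pr τ (i + 1) k)
      - (w * ∑ j ∈ Finset.range k, w ^ j) • (τ i * pr τ (i + 1) k) := by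
  induction k with
  | zero => intro i; simp [pr]
  | succ k ih =>
    intro i
    have e := congrArg (· * pr τ (i + 2) k) (H i)
    have h2 : ∑ j ∈ Finset.range (k + 2), w ^ j = ∑ j ∈ Finset.range k, w ^ j + w ^ k + w * w ^ k := by
      rw [Finset.sum_range_succ, Finset.sum_range_succ]; ring
    have h3 : w * ∑ j ∈ Finset.range k, w ^ j = ∑ j ∈ Finset.range k, w ^ j + w ^ k - 1 := by
      rw [← Finset.sum_range_succ, Finset.sum_range_succ', Finset.mul_sum]
      simp [pow_succ, mul_comm]
    rw [pr, ih (i + 1)]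
    rw [h2, Finset.sum_range_succ]
    simp only [pr, mul_sub, sub_mul, smul_mul_assoc, mul_smul_comm, mul_assoc] at *
    generalize ∑ j ∈ Finset.range k, w ^ j = g at *
    rw [h3]
    linear_combination (norm := skip) (g + w ^ k) • e
    have h4 : g = w * g - w ^ k + 1 := by rw [h3]; ring
    match_scalars <;> first | ring1 | linear_combination h3

lemma pr_inv (d : ℕ) (w : ℂ) (hw : IsPrimitiveRoot w d) (hd : 2 ≤ d) (T τ : ℕ → M)
    (H : ∀ m, T m * T (m + 1) = (1 + w) • (T m * τ (m + 1)) - w • (τ m * τ (m + 1))) :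
    pr T 0 d = pr τ 0 d := by
  obtain ⟨k, rfl⟩ : ∃ k, d = k + 1 := ⟨d - 1, by omega⟩
  have h0 := hw.geom_sum_eq_zero (by omega)
  rw [pr_rec w T τ H k 0, h0]
  rw [Finset.sum_range_succ'] at h0
  have : w * ∑ j ∈ Finset.range k, w ^ j = -1 := by
    rw [Finset.mul_sum]
    simp only [pow_succ, pow_zero] at h0
    simp only [mul_comm w]
    linear_combination h0
  rw [this]
  simp [pr]

lemma pr_expand (a b : ℕ → M) (k : ℕ) : ∀ i, ∃ c : ℕ → M, c 0 = pr a i k ∧ c k = pr b i k ∧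
    (∀ j, k < j → c j = 0) ∧
    ∀ s : ℂ, pr (fun m => a m + s • b m) i k = ∑ j ∈ Finset.range (k + 1), s ^ j • c j := by
  induction k with
  | zero => intro i; exact ⟨fun j => if j = 0 then 1 else 0, by simp [pr], by simp [pr],
      by intro j hj; simp; omega, by simp [pr]⟩
  | succ k ih =>
    intro i
    obtain ⟨c, h0, hk, hc, hs⟩ := ih (i + 1)
    refine ⟨fun j => a i * c j + (if j = 0 then 0 else b i * c (j - 1)), ?_, ?_, ?_, ?_⟩
    · simp [pr, h0]
    · simp [pr, hk, hc]
    · intro j hj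
      obtain ⟨j, rfl⟩ : ∃ l, j = l + 1 := ⟨j - 1, by omega⟩
      simp [hc j (by omega), hc (j + 1) (by omega)]
    · intro s
      rw [pr, hs]
      simp only [smul_add, Finset.sum_add_distrib]
      rw [Finset.sum_range_succ' (fun j => s ^ j • (if j = 0 then (0 : M) else b i * c (j - 1)))]
      rw [Finset.sum_range_succ (fun j => s ^ j • (a i * c j)) (k + 1)]
      simp [hc (k + 1), add_mul, Finset.mul_sum, pow_succ, smul_smul, mul_comm, Finset.smul_sum, Finset.sum_add_distrib]

lemma pr_split (d : ℕ) (w : ℂ) (hw : IsPrimitiveRoot w d) (hd : 2 ≤ d) (a b : ℕ → M)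
    (H : ∀ s : ℂ, pr (fun m => a m + (w * s) • b m) 0 d = pr (fun m => a m + s • b m) 0 d) :
    pr (fun m => a m + b m) 0 d = pr a 0 d + pr b 0 d := by
  obtain ⟨c, h0, hk, -, hs⟩ := pr_expand a b d 0
  have H1 : ∀ k : ℕ, pr (fun m => a m + (w ^ k) • b m) 0 d = pr (fun m => a m + b m) 0 d := by
    intro k
    induction k with
    | zero => simp
    | succ k ih => rw [pow_succ', H, ih]
  have H2 : (d : ℂ) • pr (fun m => a m + b m) 0 d = (d : ℂ) • (pr a 0 d + pr b 0 d) := by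
    calc (d : ℂ) • pr (fun m => a m + b m) 0 d
        = ∑ k ∈ Finset.range d, pr (fun m => a m + (w ^ k) • b m) 0 d := by
          simp only [H1]; simp [Nat.cast_smul_eq_nsmul]
      _ = ∑ j ∈ Finset.range (d + 1), (∑ k ∈ Finset.range d, (w ^ k) ^ j) • c j := by
          simp only [hs, Finset.sum_smul]
          rw [Finset.sum_comm]
      _ = (d : ℂ) • (pr a 0 d + pr b 0 d) := by
          obtain ⟨e, rfl⟩ : ∃ e, d = e + 1 := ⟨d - 1, by omega⟩
          rw [Finset.sum_range_succ, Finset.sum_range_succ', Finset.sum_eq_zero, hk, h0]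
          · have : ∀ k, (w ^ k) ^ (e + 1) = 1 := by
              intro k; rw [← pow_mul, mul_comm, pow_mul, hw.pow_eq_one, one_pow]
            simp [this]
          · intro j hj
            have hj := Finset.mem_range.1 hj
            have h1 : w ^ (j + 1) ≠ 1 := hw.pow_ne_one_of_pos_of_lt (by omega) (by omega)
            have h2 := mul_geom_sum (w ^ (j + 1)) (e + 1)
            rw [← pow_mul, mul_comm (j + 1), pow_mul, hw.pow_eq_one, one_pow, sub_self] at h2
            have h3 := (mul_eq_zero.1 h2).resolve_left (sub_ne_zero.2 h1)
            have : ∑ k ∈ Finset.range (e + 1), (w ^ k) ^ (j + 1) = 0 := by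
              rw [← h3]; apply Finset.sum_congr rfl; intro k _; rw [← pow_mul, ← pow_mul, mul_comm]
            rw [this, zero_smul]
  have hdc : (d : ℂ) ≠ 0 := by exact_mod_cast (by omega : d ≠ 0)
  have H3 := congrArg ((d : ℂ)⁻¹ • ·) H2
  simpa [smul_smul, hdc] using H3

lemma pr_smul (c : ℕ → ℂ) (h : M) (B : ℕ → M) (hc : ∀ m, B m * h = h * B m) (k : ℕ) :
    ∀ i, pr (fun m => c m • (h * B m)) i k
      = (∏ j ∈ Finset.range k, c (i + j)) • (h ^ k * pr B i k) := by
  induction k with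
  | zero => intro i; simp [pr]
  | succ k ih =>
    intro i
    have : B i * h ^ k = h ^ k * B i := (Commute.pow_right (hc i : Commute _ _) k)
    rw [pr, ih, Finset.prod_range_succ', pr, pow_succ']
    simp only [smul_mul_assoc, mul_smul_comm, smul_smul, mul_assoc]
    rw [← mul_assoc (B i), this]
    simp only [mul_assoc, add_zero, add_assoc, add_comm 1]

lemma pr_succ_last (T : ℕ → M) (k : ℕ) : ∀ i, pr T i (k + 1) = pr T i k * T (i + k) := by
  induction k with
  | zero => intro i; simp [pr]
  | succ k ih => intro i; rw [pr, ih, pr]; simp only [mul_assoc]; congr 3; ring_nf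

lemma pr_commute (T : ℕ → M) (x : M) (hx : ∀ m, Commute x (T m)) (k : ℕ) :
    ∀ i, Commute x (pr T i k) := by
  induction k with
  | zero => intro i; exact Commute.one_right x
  | succ k ih => intro i; exact (hx i).mul_right (ih _)

lemma pr_reverse (T : ℕ → M) (hc : ∀ m n, Commute (T m) (T n)) (k : ℕ) :
    ((List.range k).map (fun i => T (k - 1 - i))).prod = pr T 0 k := by
  induction k with
  | zero => simp [pr]
  | succ k ih =>
    rw [pr_succ_last, List.range_succ_eq_map]
    simp only [List.map_cons, List.prod_cons, List.map_map]
    rw [← (pr_commute T (T (0 + k)) (fun m => hc _ _) k 0).eq, ← ih]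
    simp
    congr 3
    ext i
    simp
    congr 1
    omega

lemma omega_prod (d : ℕ) (hd : 2 ≤ d) (x : ℂ) :
    ∏ j ∈ Finset.range d, (-(x * omegaD d ^ j)) = -(x ^ d) := by
  have h1 : ∏ j ∈ Finset.range d, omegaD d ^ j = (-1) ^ (d - 1) := by
    rw [Finset.prod_pow_eq_pow_sum, omegaD, ← Complex.exp_nat_mul, ← Complex.exp_pi_mul_I,
      ← Complex.exp_nat_mul]
    congr 1
    have h2 := Finset.sum_range_id_mul_two d
    have h3 : ((∑ i ∈ Finset.range d, i : ℕ) : ℂ) * 2 = d * ((d - 1 : ℕ) : ℂ) := by exact_mod_cast h2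
    have hdc : (d : ℂ) ≠ 0 := by exact_mod_cast (by omega : d ≠ 0)
    field_simp
    linear_combination h3
  have h2 : ∀ j, -(x * omegaD d ^ j) = (-x) * omegaD d ^ j := by intro j; ring
  simp only [h2]
  rw [Finset.prod_mul_distrib, h1, Finset.prod_const, Finset.card_range, neg_pow]
  obtain ⟨e, rfl⟩ : ∃ e, d = e + 1 := ⟨d - 1, by omega⟩
  simp only [Nat.add_sub_cancel]
  have : ((-1 : ℂ) ^ e) * (-1) ^ e = 1 := by rw [← mul_pow]; simp
  linear_combination (-(x ^ (e + 1))) * this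

end Abstract2
section GraphPart
variable {V : Type*} [LinearOrder V] {N : ℕ}

def nb (G : SimpleGraph V) (W : Finset V) (v : V) : Finset V :=
  W.filter (fun u => u ≠ v ∧ ¬ G.Adj u v)

lemma mem_nb {G : SimpleGraph V} {W : Finset V} {v u : V} :
    u ∈ nb G W v ↔ u ∈ W ∧ u ≠ v ∧ ¬ G.Adj u v := by simp [nb]

lemma indep_insert {G : SimpleGraph V} {S : Finset V} {v : V} (hv : v ∉ S) :
    IsIndep G (insert v S) ↔ IsIndep G S ∧ ∀ u ∈ S, ¬ G.Adj u v := by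
  constructor
  · intro H
    refine ⟨fun u hu w hw => H u (Finset.mem_insert_of_mem hu) w (Finset.mem_insert_of_mem hw),
      fun u hu => H u (Finset.mem_insert_of_mem hu) v (Finset.mem_insert_self _ _) ?_⟩
    rintro rfl; exact hv hu
  · rintro ⟨H1, H2⟩ u hu w hw huw
    rcases Finset.mem_insert.1 hu with rfl | hu
    · rcases Finset.mem_insert.1 hw with rfl | hw
      · exact absurd rfl huw
      · exact fun h => H2 w hw h.symm
    · rcases Finset.mem_insert.1 hw with rfl | hw
      · exact H2 _ (by assumption)
      · exact H1 u hu w hw huw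

lemma sum_split {E : Type*} [AddCommMonoid E] (G : SimpleGraph V) (W : Finset V) (v : V)
    (hv : v ∈ W) (F : Finset V → E) :
    ∑ S ∈ W.powerset.filter (fun S => IsIndep G S), F S
      = ∑ S ∈ (W.erase v).powerset.filter (fun S => IsIndep G S), F S
      + ∑ S ∈ (nb G W v).powerset.filter (fun S => IsIndep G S), F (insert v S) := by
  rw [← Finset.sum_filter_add_sum_filter_not _ (fun S => v ∉ S)]
  congr 1
  · apply Finset.sum_congr _ (fun _ _ => rfl)
    ext S
    simp only [Finset.mem_filter, Finset.mem_powerset, Finset.subset_erase]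
    tauto
  · symm
    refine Finset.sum_bij' (fun S _ => insert v S) (fun S _ => S.erase v) ?_ ?_ ?_ ?_ ?_
    · intro S hS
      simp only [Finset.mem_filter, Finset.mem_powerset] at hS ⊢
      have hvS : v ∉ S := fun h => (mem_nb.1 (hS.1 h)).2.1 rfl
      refine ⟨⟨?_, (indep_insert hvS).2 ⟨hS.2, fun u hu => (mem_nb.1 (hS.1 hu)).2.2⟩⟩, by simp⟩
      exact Finset.insert_subset hv (fun u hu => (mem_nb.1 (hS.1 hu)).1)
    · intro S hS
      simp only [Finset.mem_filter, Finset.mem_powerset, not_not] at hS ⊢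
      obtain ⟨⟨h1, h2⟩, h3⟩ := hS
      rw [← Finset.insert_erase h3, indep_insert (Finset.notMem_erase v S)] at h2
      refine ⟨fun u hu => mem_nb.2 ⟨h1 (Finset.mem_of_mem_erase hu), Finset.ne_of_mem_erase hu,
        h2.2 u hu⟩, h2.1⟩
    · intro S hS
      simp only [Finset.mem_filter, Finset.mem_powerset] at hS
      have hvS : v ∉ S := fun h => (mem_nb.1 (hS.1 h)).2.1 rfl
      exact Finset.erase_insert hvS
    · intro S hS
      simp only [Finset.mem_filter, not_not] at hS
      exact Finset.insert_erase hS.2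
    · intro S hS; rfl

def TT (G : SimpleGraph V) (h : V → Matrix (Fin N) (Fin N) ℂ) (W : Finset V) (x : ℂ) :
    Matrix (Fin N) (Fin N) ℂ :=
  ∑ S ∈ W.powerset.filter (fun S => IsIndep G S), (-x) ^ S.card • hProd h S

lemma transferT_eq (G : SimpleGraph V) (h : V → Matrix (Fin N) (Fin N) ℂ) (W : Finset V) (x : ℂ) :
    transferT G h W x = TT G h W x := by
  unfold transferT TT chargeQ
  have hmem : ∀ S ∈ W.powerset.filter (fun S => IsIndep G S),
      S.card ∈ Finset.range (indepNum G W + 1) := by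
    intro S hS
    rw [Finset.mem_range, Nat.lt_succ_iff]
    exact Finset.le_sup (f := Finset.card) hS
  rw [← Finset.sum_fiberwise_of_maps_to hmem]
  apply Finset.sum_congr rfl
  intro k _
  rw [Finset.smul_sum, Finset.filter_filter]
  apply Finset.sum_congr rfl
  intro S hS
  rw [(Finset.mem_filter.1 hS).2.2]

structure Ctx (d : ℕ) (G : SimpleGraph V) (dir : V → V → Prop) (f : V → ℕ)
    (h : V → Matrix (Fin N) (Fin N) ℂ) : Prop where
  hdir : ∀ u v, dir u v → G.Adj u v
  hdir' : ∀ u v, G.Adj u v → (dir u v ↔ ¬ dir v u)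
  hdip : DipathOriented G dir
  hopeo : IsOPEO G dir f
  hcd : ∀ u w, dir u w → h u * h w = omegaD d • (h w * h u)
  hcn : ∀ u w, u ≠ w → ¬ G.Adj u w → h u * h w = h w * h u

variable {d : ℕ} {G : SimpleGraph V} {dir : V → V → Prop} {f : V → ℕ}
  {h : V → Matrix (Fin N) (Fin N) ℂ}

lemma hProd_insert (C : Ctx d G dir f h) {S : Finset V} {v : V} (hv : v ∉ S)
    (hi : IsIndep G (insert v S)) : hProd h (insert v S) = h v * hProd h S := by
  unfold hProd
  rw [← List.prod_cons, ← List.map_cons]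
  have hp : List.Perm ((insert v S).sort (· ≤ ·)) (v :: S.sort (· ≤ ·)) := by
    rw [List.perm_ext_iff_of_nodup]
    · intro a; simp
    · exact Finset.sort_nodup _ _
    · simp [hv]
  apply (hp.map h).prod_eq'
  rw [List.pairwise_map]
  apply List.Pairwise.imp_of_mem _ (Finset.sort_nodup (insert v S) (· ≤ ·))
  intro a b ha hb hab
  rw [Finset.mem_sort] at ha hb
  exact C.hcn a b hab (hi a ha b hb hab)

lemma TT_step (C : Ctx d G dir f h) {W : Finset V} {v : V} (hv : v ∈ W) (x : ℂ) :
    TT G h W x = TT G h (W.erase v) x - x • (h v * TT G h (nb G W v) x) := by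
  unfold TT
  rw [sum_split G W v hv, sub_eq_add_neg]
  congr 1
  rw [Finset.mul_sum, Finset.smul_sum, ← Finset.sum_neg_distrib]
  apply Finset.sum_congr rfl
  intro S hS
  simp only [Finset.mem_filter, Finset.mem_powerset] at hS
  have hvS : v ∉ S := fun h => (mem_nb.1 (hS.1 h)).2.1 rfl
  have hi : IsIndep G (insert v S) :=
    (indep_insert hvS).2 ⟨hS.2, fun u hu => (mem_nb.1 (hS.1 hu)).2.2⟩
  rw [hProd_insert C hvS hi, Finset.card_insert_of_notMem hvS, mul_smul_comm, smul_smul, ← neg_smul]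
  congr 1
  ring

lemma Z_step {w : V → ℂ} {W : Finset V} {v : V} (hv : v ∈ W) (x : ℂ) :
    indepPoly G w W x = indepPoly G w (W.erase v) x + x * w v * indepPoly G w (nb G W v) x := by
  unfold indepPoly
  rw [sum_split G W v hv, Finset.mul_sum]
  congr 1
  apply Finset.sum_congr rfl
  intro S hS
  simp only [Finset.mem_filter, Finset.mem_powerset] at hS
  have hvS : v ∉ S := fun h => (mem_nb.1 (hS.1 h)).2.1 rfl
  rw [Finset.prod_insert hvS]

lemma TT_empty (x : ℂ) : TT G h ∅ x = 1 := by
  have : IsIndep G ∅ := by simp [IsIndep]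
  simp [TT, hProd, Finset.filter_singleton, this]

/-- an element commuting with all `h u`, `u ∈ W`, commutes with `TT W`. -/
lemma TT_commute {W : Finset V} (M : Matrix (Fin N) (Fin N) ℂ)
    (hM : ∀ u ∈ W, Commute M (h u)) (x : ℂ) : Commute M (TT G h W x) := by
  unfold TT
  apply Commute.sum_right
  intro S hS
  simp only [Finset.mem_filter, Finset.mem_powerset] at hS
  apply Commute.smul_right
  unfold hProd
  apply Commute.list_prod_right
  intro y hy
  obtain ⟨u, hu, rfl⟩ := List.mem_map.1 hy
  exact hM u (hS.1 ((Finset.mem_sort _).1 hu))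

lemma TT_clique (C : Ctx d G dir f h) (R : Finset V) (x : ℂ) (K : Finset V) :
    (Disjoint R K) → (∀ a ∈ K, ∀ b ∈ K, a ≠ b → G.Adj a b) →
    TT G h (R ∪ K) x = TT G h R x - x • ∑ k ∈ K, h k * TT G h (nb G R k) x := by
  induction K using Finset.induction_on with
  | empty => intros; simp
  | insert k K hk ih =>
    intro hd hc
    have hkR : k ∉ R := fun hh => Finset.disjoint_left.1 hd hh (Finset.mem_insert_self _ _)
    rw [TT_step C (v := k) (by simp), Finset.sum_insert hk]
    have e1 : (R ∪ insert k K).erase k = R ∪ K := by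
      ext a; simp only [Finset.mem_erase, Finset.mem_union, Finset.mem_insert]
      constructor
      · tauto
      · rintro (ha | ha)
        · exact ⟨fun h => hkR (h ▸ ha), Or.inl ha⟩
        · exact ⟨fun h => hk (h ▸ ha), Or.inr (Or.inr ha)⟩
    have e2 : nb G (R ∪ insert k K) k = nb G R k := by
      ext a; simp only [mem_nb, Finset.mem_union, Finset.mem_insert]
      constructor
      · rintro ⟨ha | ha | ha, h2, h3⟩
        · exact ⟨ha, h2, h3⟩
        · exact absurd ha h2
        · exact absurd (hc a (by simp [ha]) k (by simp) h2) h3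
      · tauto
    rw [e1, e2, ih (hd.mono_right (Finset.subset_insert _ _))
      (fun a ha b hb => hc a (by simp [ha]) b (by simp [hb])), smul_add]
    abel

/-- `v` is a sink-like simplicial vertex of `W`. -/
def IsLastIn (G : SimpleGraph V) (dir : V → V → Prop) (W : Finset V) (v : V) : Prop :=
  v ∈ W ∧ ∀ u ∈ W, G.Adj u v → dir u v

def nbr (G : SimpleGraph V) (W : Finset V) (v : V) : Finset V := W.filter (fun u => G.Adj u v)

lemma mem_nbr {W : Finset V} {v u : V} : u ∈ nbr G W v ↔ u ∈ W ∧ G.Adj u v := by simp [nbr]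

lemma nbr_clique (C : Ctx d G dir f h) {W : Finset V} {v : V} (hl : IsLastIn G dir W v) :
    ∀ a ∈ nbr G W v, ∀ b ∈ nbr G W v, a ≠ b → G.Adj a b := by
  intro a ha b hb hab
  rw [mem_nbr] at ha hb
  exact C.hopeo.2.1 v a b ha.2 hb.2 (C.hopeo.2.2 _ _ (hl.2 a ha.1 ha.2))
    (C.hopeo.2.2 _ _ (hl.2 b hb.1 hb.2)) hab

lemma nb_nbr_disj {W : Finset V} {v : V} : Disjoint (nb G W v) (nbr G W v) := by
  rw [Finset.disjoint_left]
  intro a ha hb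
  exact (mem_nb.1 ha).2.2 (mem_nbr.1 hb).2

lemma erase_eq {W : Finset V} {v : V} : W.erase v = nb G W v ∪ nbr G W v := by
  ext a
  simp only [Finset.mem_erase, Finset.mem_union, mem_nb, mem_nbr]
  constructor
  · tauto
  · rintro (h | h)
    · tauto
    · exact ⟨fun e => G.loopless.irrefl v (e ▸ h.2), h.1⟩

lemma TT_erase (C : Ctx d G dir f h) {W : Finset V} {v : V} (hl : IsLastIn G dir W v) (x : ℂ) :
    TT G h (W.erase v) x = TT G h (nb G W v) x
      - x • ∑ k ∈ nbr G W v, h k * TT G h (nb G (nb G W v) k) x := by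
  rw [erase_eq (G := G)]
  exact TT_clique C _ x _ nb_nbr_disj (nbr_clique C hl)

lemma B_comm (C : Ctx d G dir f h) {W : Finset V} {v : V} (x : ℂ) :
    TT G h (nb G W v) x * h v = h v * TT G h (nb G W v) x := by
  symm
  apply TT_commute
  intro u hu
  rw [mem_nb] at hu
  exact (C.hcn u v hu.2.1 hu.2.2).symm

lemma A_comm (C : Ctx d G dir f h) {W : Finset V} {v : V} (hl : IsLastIn G dir W v) (x : ℂ) :
    TT G h (W.erase v) x * h v = omegaD d • (h v * TT G h (W.erase v) x)
      + (1 - omegaD d) • (h v * TT G h (nb G W v) x) := by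
  have key : (∑ k ∈ nbr G W v, h k * TT G h (nb G (nb G W v) k) x) * h v
      = omegaD d • (h v * ∑ k ∈ nbr G W v, h k * TT G h (nb G (nb G W v) k) x) := by
    rw [Finset.sum_mul, Finset.mul_sum, Finset.smul_sum]
    apply Finset.sum_congr rfl
    intro k hk
    rw [mem_nbr] at hk
    have h1 : Commute (h v) (TT G h (nb G (nb G W v) k) x) := by
      apply TT_commute
      intro u hu
      have hu := mem_nb.1 (mem_nb.1 hu).1
      exact (C.hcn u v hu.2.1 hu.2.2).symm
    rw [mul_assoc, ← h1.eq, ← mul_assoc, C.hcd k v (hl.2 k hk.1 hk.2), smul_mul_assoc, mul_assoc]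
  rw [TT_erase C hl, sub_mul, B_comm C, smul_mul_assoc, key, mul_sub, mul_smul_comm]
  module

lemma last_nbr (C : Ctx d G dir f h) {W : Finset V} {v k : V} (hl : IsLastIn G dir W v)
    (hk : k ∈ nbr G W v) : IsLastIn G dir (insert k (nb G W v)) k := by
  refine ⟨Finset.mem_insert_self _ _, ?_⟩
  intro r hr hrk
  rw [mem_nbr] at hk
  rcases Finset.mem_insert.1 hr with rfl | hr
  · exact absurd hrk (G.loopless.irrefl _)
  rw [mem_nb] at hr
  have hkv := hl.2 k hk.1 hk.2
  have hp : IsInducedPath G (n := 2) ![r, k, v] := by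
    have hrk' : r ≠ k := hrk.ne
    have hkv' : k ≠ v := hk.2.ne
    have := hr.2.1
    have h4 : ¬ G.Adj v r := fun h => hr.2.2 h.symm
    constructor
    · intro i j hij
      fin_cases i <;> fin_cases j <;> simp_all [eq_comm]
    · intro i j
      fin_cases i <;> fin_cases j <;> simp [hrk, hrk.symm, hk.2, hk.2.symm, h4, hr.2.2]
  rcases C.hdip 2 _ hp with H | H
  · exact H 0
  · exact absurd (H 1) ((C.hdir' k v hk.2).1 hkv)

lemma last_of_max (C : Ctx d G dir f h) {W : Finset V} {v : V} (hv : v ∈ W)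
    (hmax : ∀ a ∈ W, f a ≤ f v) : IsLastIn G dir W v := by
  refine ⟨hv, fun a ha hav => ?_⟩
  by_contra hc
  have : dir v a := by
    by_contra hc2
    exact hc ((C.hdir' a v hav).2 hc2)
  exact absurd (C.hopeo.2.2 _ _ this) (not_lt.2 (hmax a ha))

lemma exists_last (C : Ctx d G dir f h) (W : Finset V) (hne : W.Nonempty) :
    ∃ v, IsLastIn G dir W v := by
  obtain ⟨v, hv, hmax⟩ := Finset.exists_max_image W f hne
  exact ⟨v, last_of_max C hv hmax⟩

lemma main_ind (C : Ctx d G dir f h) (n : ℕ) : ∀ W : Finset V, W.card = n →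
    (∀ x u, TT G h W x * TT G h W u = TT G h W u * TT G h W x) ∧
    (∀ v, IsLastIn G dir W v → ∀ x u,
      TT G h (W.erase v) x * TT G h (nb G W v) u - TT G h (nb G W v) u * TT G h (W.erase v) x
      = TT G h (W.erase v) u * TT G h (nb G W v) x
        - TT G h (nb G W v) x * TT G h (W.erase v) u) := by
  induction n using Nat.strong_induction_on with
  | _ n IH =>
  intro W hW
  have IH' : ∀ W' : Finset V, W' ⊂ W → _ := fun W' hW' =>
    IH W'.card (hW ▸ Finset.card_lt_card hW') W' rfl
  have nbss : ∀ v ∈ W, nb G W v ⊂ W := fun v hv =>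
    (Finset.ssubset_iff_of_subset (Finset.filter_subset _ _)).2
      ⟨v, hv, fun hh => (mem_nb.1 hh).2.1 rfl⟩
  have hk : ∀ v, IsLastIn G dir W v → ∀ k ∈ nbr G W v, ∀ x u,
      (omegaD d • (h k * TT G h (nb G (nb G W v) k) x * TT G h (nb G W v) u)
        - TT G h (nb G W v) u * (h k * TT G h (nb G (nb G W v) k) x)
       = omegaD d • (h k * TT G h (nb G (nb G W v) k) u * TT G h (nb G W v) x)
        - TT G h (nb G W v) x * (h k * TT G h (nb G (nb G W v) k) u)) ∧
      (x • (h k * TT G h (nb G (nb G W v) k) x * TT G h (nb G W v) u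
        - TT G h (nb G W v) u * (h k * TT G h (nb G (nb G W v) k) x))
       = u • (h k * TT G h (nb G (nb G W v) k) u * TT G h (nb G W v) x
        - TT G h (nb G W v) x * (h k * TT G h (nb G (nb G W v) k) u))) := by
    intro v hl k hk x u
    have hlk := last_nbr C hl hk
    have hk' := mem_nbr.1 hk
    have hkR : k ∉ nb G W v := fun hh => (mem_nb.1 hh).2.2 hk'.2
    have hss : insert k (nb G W v) ⊂ W := by
      rw [Finset.ssubset_iff_of_subset]
      · refine ⟨v, hl.1, fun hh => ?_⟩
        rcases Finset.mem_insert.1 hh with e | e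
        · exact hk'.2.ne e.symm
        · exact (mem_nb.1 e).2.1 rfl
      · exact Finset.insert_subset hk'.1 (Finset.filter_subset _ _)
    have e1 : (insert k (nb G W v)).erase k = nb G W v := Finset.erase_insert hkR
    have e2 : nb G (insert k (nb G W v)) k = nb G (nb G W v) k := by
      ext a; simp only [mem_nb, Finset.mem_insert]; tauto
    obtain ⟨c1, c2⟩ := IH' _ hss
    obtain ⟨c3, -⟩ := IH' _ (nbss v hl.1)
    obtain ⟨c4, -⟩ := IH' (nb G (nb G W v) k)
      (lt_of_le_of_lt (Finset.filter_subset _ _) (nbss v hl.1))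
    have a1 := A_comm C hlk
    have b1 := B_comm C (W := nb G W v) (v := k)
    have s1 := c2 k hlk
    have t1 := c1 x u
    rw [TT_step C hlk.1 x, TT_step C hlk.1 u] at t1
    simp only [e1, e2] at a1 s1 t1
    exact ⟨abs_i _ _ _ _ _ _ (a1 x) (a1 u) (c4 x u) (s1 x u),
      abs_ii x u _ _ _ _ _ (b1 x) (b1 u) (c4 x u) (c3 x u) t1⟩
  constructor
  · intro x u
    rcases W.eq_empty_or_nonempty with rfl | hne
    · simp [TT_empty]
    obtain ⟨v, hl⟩ := exists_last C W hne
    have hv := hl.1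
    rw [TT_step C hv x, TT_step C hv u]
    refine abs_comm (omegaD d) x u _ _ _ _ _
      (-(x • ∑ k ∈ nbr G W v, h k * TT G h (nb G (nb G W v) k) x))
      (-(u • ∑ k ∈ nbr G W v, h k * TT G h (nb G (nb G W v) k) u))
      (A_comm C hl x) (A_comm C hl u) (B_comm C x) (B_comm C u)
      ((IH' _ (Finset.erase_ssubset hv)).1 x u) ((IH' _ (nbss v hv)).1 x u)
      (by rw [TT_erase C hl, sub_eq_add_neg]) (by rw [TT_erase C hl, sub_eq_add_neg]) ?_
    have := Finset.sum_congr rfl (fun k hk' => (hk v hl k hk' x u).1)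
    simp only [Finset.sum_sub_distrib, ← Finset.smul_sum, ← Finset.sum_mul, ← Finset.mul_sum] at this
    simp only [neg_mul, mul_neg, smul_mul_assoc, mul_smul_comm]
    linear_combination (norm := module) (-(x * u)) • this
  · intro v hl x u
    have := Finset.sum_congr rfl (fun k hk' => (hk v hl k hk' x u).2)
    simp only [Finset.sum_sub_distrib, ← Finset.smul_sum, ← Finset.sum_mul, ← Finset.mul_sum] at this
    have hBB := (IH' _ (nbss v hl.1)).1 x u
    rw [TT_erase C hl, TT_erase C hl]
    simp only [sub_mul, mul_sub, smul_mul_assoc, mul_smul_comm]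
    linear_combination (norm := module) (-1 : ℂ) • this + (2 : ℂ) • hBB

end GraphPart
section FinalPart
variable {V : Type*} [LinearOrder V] {N : ℕ}
variable {d : ℕ} {G : SimpleGraph V} {dir : V → V → Prop} {f : V → ℕ}
  {h : V → Matrix (Fin N) (Fin N) ℂ}

lemma TT_comm (C : Ctx d G dir f h) (W : Finset V) (x u : ℂ) :
    TT G h W x * TT G h W u = TT G h W u * TT G h W x :=
  (main_ind C _ W rfl).1 x u

lemma omega_prim (hd : 2 ≤ d) : IsPrimitiveRoot (omegaD d) d :=
  Complex.isPrimitiveRoot_exp d (by omega)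

lemma star (C : Ctx d G dir f h) {W : Finset V} {v : V} (hl : IsLastIn G dir W v) (s x u : ℂ) :
    (x - u) • ((TT G h (W.erase v) x - (omegaD d * s * x) • (h v * TT G h (nb G W v) x))
        * (TT G h (W.erase v) u - (omegaD d * s * u) • (h v * TT G h (nb G W v) u)))
    - (x - omegaD d * u) • ((TT G h (W.erase v) x - (omegaD d * s * x) • (h v * TT G h (nb G W v) x))
        * (TT G h (W.erase v) u - (s * u) • (h v * TT G h (nb G W v) u)))
    + (u - omegaD d * x) • ((TT G h (W.erase v) u - (omegaD d * s * u) • (h v * TT G h (nb G W v) u))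
        * (TT G h (W.erase v) x - (s * x) • (h v * TT G h (nb G W v) x)))
    + (omegaD d * (x - u)) • ((TT G h (W.erase v) u - (s * u) • (h v * TT G h (nb G W v) u))
        * (TT G h (W.erase v) x - (s * x) • (h v * TT G h (nb G W v) x))) = 0 :=
  abs_star (omegaD d) s x u (h v) _ _ _ _ (A_comm C hl x) (A_comm C hl u)
    (B_comm C x) (B_comm C u) (TT_comm C _ x u) (TT_comm C _ x u) ((main_ind C _ W rfl).2 v hl x u)

lemma prod_formula (C : Ctx d G dir f h) (hd : 2 ≤ d) (b : V → ℝ)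
    (hpow : ∀ w, h w ^ d = ((b w : ℂ) ^ d) • (1 : Matrix (Fin N) (Fin N) ℂ))
    (x : ℂ) (hx : x ≠ 0) (n : ℕ) : ∀ W : Finset V, W.card = n →
    pr (fun m => TT G h W (x * omegaD d ^ m)) 0 d
      = indepPoly G (fun w => (b w : ℂ) ^ d) W (-(x ^ d)) • (1 : Matrix (Fin N) (Fin N) ℂ) := by
  induction n using Nat.strong_induction_on with
  | _ n IH =>
  intro W hW
  rcases W.eq_empty_or_nonempty with rfl | hne
  · simp only [TT_empty]
    have h1 : ∀ k i, pr (fun _ => (1 : Matrix (Fin N) (Fin N) ℂ)) i k = 1 := by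
      intro k
      induction k with
      | zero => intro i; rfl
      | succ k ih => intro i; simp [pr, ih]
    have : IsIndep G ∅ := by simp [IsIndep]
    simp [h1, indepPoly, Finset.filter_singleton, this]
  obtain ⟨v, hl⟩ := exists_last C W hne
  have hv := hl.1
  have nbss : nb G W v ⊂ W :=
    (Finset.ssubset_iff_of_subset (Finset.filter_subset _ _)).2
      ⟨v, hv, fun hh => (mem_nb.1 hh).2.1 rfl⟩
  have hA := IH _ (hW ▸ Finset.card_lt_card (Finset.erase_ssubset hv)) _ rfl
  have hB := IH _ (hW ▸ Finset.card_lt_card nbss) _ rfl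
  have hw := omega_prim hd
  have hw0 : omegaD d ≠ 0 := hw.ne_zero (by omega)
  have hw1 : omegaD d ≠ 1 := hw.ne_one (by omega)
  have step : ∀ m : ℕ, TT G h W (x * omegaD d ^ m) = TT G h (W.erase v) (x * omegaD d ^ m)
      + (-(x * omegaD d ^ m)) • (h v * TT G h (nb G W v) (x * omegaD d ^ m)) := by
    intro m; rw [TT_step C hv, neg_smul, sub_eq_add_neg]
  simp only [step]
  rw [pr_split d (omegaD d) hw hd, pr_smul (fun m => -(x * omegaD d ^ m)) (h v) _ (fun m => B_comm C _), hA, hB, Z_step hv]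
  · simp only [zero_add]
    rw [omega_prod d hd, hpow, smul_mul_assoc, one_mul, smul_smul, smul_smul, ← add_smul]
  · intro s
    apply pr_inv d (omegaD d) hw hd
    intro m
    have hs := star C hl s (x * omegaD d ^ m) (x * omegaD d ^ (m + 1))
    have hc := abs_comm_scale s (x * omegaD d ^ m) (x * omegaD d ^ (m + 1)) (h v) _ _ _ _
      (B_comm C _) (B_comm C _) (TT_comm C _ _ _) (TT_comm C _ _ _) (by
        rw [← TT_step C hv, ← TT_step C hv]; exact TT_comm C _ _ _)
    have hT : ∀ (s : ℂ) (k : ℕ), TT G h (W.erase v) (x * omegaD d ^ k)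
          + s • (-(x * omegaD d ^ k)) • (h v * TT G h (nb G W v) (x * omegaD d ^ k))
        = TT G h (W.erase v) (x * omegaD d ^ k)
          - (s * (x * omegaD d ^ k)) • (h v * TT G h (nb G W v) (x * omegaD d ^ k)) := by
      intro s k; module
    simp only [hT]
    rw [← hc] at hs
    have hy : x * omegaD d ^ m * (1 - omegaD d) ≠ 0 :=
      mul_ne_zero (mul_ne_zero hx (pow_ne_zero _ hw0)) (sub_ne_zero.2 hw1.symm)
    rw [← sub_eq_zero]
    apply (smul_eq_zero.1 ?_).resolve_left hy
    rw [← hs]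
    module

lemma tau (C : Ctx d G dir f h) (hd : 2 ≤ d) {W : Finset V} {v : V} (hv : v ∈ W)
    (χ : Matrix (Fin N) (Fin N) ℂ)
    (hχcomm : ∀ u, u ≠ v → χ * h u = h u * χ)
    (hχv : h v * χ = omegaD d • (χ * h v)) (x : ℂ) :
    (TT G h (W.erase v) x - ((omegaD d)⁻¹ * x) • (h v * TT G h (nb G W v) x)) * χ
      = χ * TT G h W x := by
  have hw0 : omegaD d ≠ 0 := (omega_prim hd).ne_zero (by omega)
  have h1 : Commute χ (TT G h (W.erase v) x) :=
    TT_commute χ (fun u hu => hχcomm u (Finset.ne_of_mem_erase hu)) x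
  have h2 : Commute χ (TT G h (nb G W v) x) :=
    TT_commute χ (fun u hu => hχcomm u (mem_nb.1 hu).2.1) x
  rw [TT_step C hv, sub_mul, mul_sub, h1.eq, smul_mul_assoc, mul_assoc, ← h2.eq, ← mul_assoc, hχv,
    smul_mul_assoc, smul_smul, mul_smul_comm, mul_assoc, mul_assoc]
  congr 2
  field_simp

lemma exchange (C : Ctx d G dir f h) (hd : 2 ≤ d) {W : Finset V} {v : V}
    (hl : IsLastIn G dir W v) (χ P : Matrix (Fin N) (Fin N) ℂ)
    (hχcomm : ∀ u, u ≠ v → χ * h u = h u * χ)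
    (hχv : h v * χ = omegaD d • (χ * h v)) (x : ℂ)
    (hP : TT G h W x * P = 0) (hPc : ∀ u, TT G h W u * P = P * TT G h W u) (u : ℂ) :
    (x - u) • (TT G h W u * (TT G h W x * χ * P))
      = (x - omegaD d * u) • (TT G h W x * χ * P * TT G h W u) := by
  have hw0 : omegaD d ≠ 0 := (omega_prim hd).ne_zero (by omega)
  have hs := star C hl (omegaD d)⁻¹ x u
  simp only [mul_inv_cancel₀ hw0, one_mul] at hs
  rw [← TT_step C hl.1, ← TT_step C hl.1] at hs
  have tx := tau C hd hl.1 χ hχcomm hχv x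
  have tu := tau C hd hl.1 χ hχcomm hχv u
  replace hs : _ * χ * P = 0 * χ * P := congrArg (fun M => M * χ * P) hs
  set τx := TT G h (W.erase v) x - ((omegaD d)⁻¹ * x) • (h v * TT G h (nb G W v) x)
  set τu := TT G h (W.erase v) u - ((omegaD d)⁻¹ * u) • (h v * TT G h (nb G W v) u)
  rw [add_mul, add_mul, add_mul, add_mul, sub_mul, sub_mul] at hs
  simp only [smul_mul_assoc, zero_mul] at hs
  have r1 : TT G h W x * TT G h W u * χ * P = TT G h W u * (TT G h W x * χ * P) := by
    rw [TT_comm C]; simp only [mul_assoc]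
  have r2 : TT G h W x * τu * χ * P = TT G h W x * χ * P * TT G h W u := by
    rw [mul_assoc _ τu χ, tu]; simp only [mul_assoc, hPc]
  have r3 : TT G h W u * τx * χ * P = 0 := by
    rw [mul_assoc _ τx χ, tx]; simp only [mul_assoc, hP, mul_zero]
  have r4 : τu * τx * χ * P = 0 := by
    rw [mul_assoc _ τx χ, tx]; simp only [mul_assoc, hP, mul_zero]
  rw [r1, r2, r3, r4] at hs
  simpa [sub_eq_zero] using hs

lemma deriv_step (w x : ℂ) (n : ℕ) (Q : ℕ → Matrix (Fin N) (Fin N) ℂ)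
    (ψ : Matrix (Fin N) (Fin N) ℂ)
    (T : ℂ → Matrix (Fin N) (Fin N) ℂ) (hT : ∀ u, T u = ∑ k ∈ Finset.range n, (-u) ^ k • Q k)
    (h0 : ψ * T x = 0)
    (hex : ∀ u, (x - u) • (T u * ψ) = (x - w * u) • (ψ * T u)) :
    T x * ψ = (-(1 - w)) • (ψ * ∑ k ∈ Finset.range n, ((k : ℂ) * (-x) ^ k) • Q k) := by
  set E : ℂ → Matrix (Fin N) (Fin N) ℂ := fun u => ∑ k ∈ Finset.range n,
    (∑ i ∈ Finset.range k, (-u) ^ i * (-x) ^ (k - 1 - i)) • Q k with hE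
  have hTE : ∀ u, T u = T x + (x - u) • E u := by
    intro u
    rw [hT, hT, hE, Finset.smul_sum, ← Finset.sum_add_distrib]
    apply Finset.sum_congr rfl
    intro k _
    have := geom_sum₂_mul (-u) (-x) k
    rw [smul_smul, ← add_smul]
    congr 1
    linear_combination -this
  have key : (fun u => T u * ψ) = fun u => (x - w * u) • (ψ * E u) := by
    apply Continuous.ext_on (dense_compl_singleton x)
    · simp only [hT]; fun_prop
    · simp only [hE]; fun_prop
    · intro u hu
      have hu' : x - u ≠ 0 := sub_ne_zero.2 (Ne.symm hu)
      have h1 := hex u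
      rw [hTE u, mul_add ψ, h0, zero_add, mul_smul_comm, smul_comm, ← hTE u] at h1
      have h2 := congrArg ((x - u)⁻¹ • ·) h1
      simpa [smul_smul, hu', ← mul_assoc] using h2
  have k1 : T x * ψ = (x - w * x) • (ψ * E x) := congrFun key x
  rw [k1]
  have h3 : x • E x = -∑ k ∈ Finset.range n, ((k : ℂ) * (-x) ^ k) • Q k := by
    rw [hE, Finset.smul_sum, ← Finset.sum_neg_distrib]
    apply Finset.sum_congr rfl
    intro k _
    rw [smul_smul, ← neg_smul]
    congr 1
    have : ∀ i ∈ Finset.range k, (-x) ^ i * (-x) ^ (k - 1 - i) = (-x) ^ (k - 1) := by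
      intro i hi
      have := Finset.mem_range.1 hi
      rw [← pow_add]; congr 1; omega
    rw [Finset.sum_congr rfl this]
    rcases k with _ | k
    · simp
    · simp [pow_succ]; ring
  have h4 : (x - w * x) • (ψ * E x) = (1 - w) • (ψ * (x • E x)) := by
    rw [mul_smul_comm]; module
  rw [h4, h3]
  simp only [mul_neg]; module

end FinalPart
/-- relation between the transfer operator, a parafermionic mode,
and the derivative of the transfer operator. -/
theorem transfer_paraMode_equal_commutator
    {V : Type*} [Fintype V] [LinearOrder V] {N : ℕ}
    (d : ℕ) (hd : 2 ≤ d)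
    (G : SimpleGraph V) (dir : V → V → Prop)
    (hdir : ∀ u v, dir u v → G.Adj u v)
    (hdir' : ∀ u v, G.Adj u v → (dir u v ↔ ¬ dir v u))
    (hdip : DipathOriented G dir)
    (f : V → ℕ) (hopeo : IsOPEO G dir f)
    (v : V) (hlast : ∀ u, u ≠ v → f u < f v)
    (h : V → Matrix (Fin N) (Fin N) ℂ) (b : V → ℝ)
    (hb : ∀ w, b w ≠ 0)
    (hpow : ∀ w, h w ^ d = ((b w : ℂ) ^ d) • (1 : Matrix (Fin N) (Fin N) ℂ))
    (hcd : ∀ u w, dir u w → h u * h w = omegaD d • (h w * h u))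
    (hcn : ∀ u w, u ≠ w → ¬ G.Adj u w → h u * h w = h w * h u)
    (χ : Matrix (Fin N) (Fin N) ℂ) (hχ : IsUnit χ)
    (hχcomm : ∀ u, u ≠ v → χ * h u = h u * χ)
    (hχv : h v * χ = omegaD d • (χ * h v))
    (εk : ℂ) (hε : εk ≠ 0)
    (hZ : indepPoly G (fun w => (b w : ℂ) ^ d) Finset.univ (-(εk ^ (-(d : ℤ)))) = 0)
    (Nk : ℂ) (hN : Nk ≠ 0) :
    ∀ p : ℤ,
      transferT G h Finset.univ (εk⁻¹ * omegaD d ^ (-p)) * paraMode d G h χ εk Nk p =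
        ((1 - omegaD d) * εk) •
          (paraMode d G h χ εk Nk p * transferTderiv d G h p εk) := by
  intro p
  have C : Ctx d G dir f h := ⟨hdir, hdir', hdip, hopeo, hcd, hcn⟩
  have hw := omega_prim hd
  have hw0 : omegaD d ≠ 0 := hw.ne_zero (by omega)
  have hl : IsLastIn G dir Finset.univ v := by
    apply last_of_max C (Finset.mem_univ v)
    intro a _
    by_cases hav : a = v
    · rw [hav]
    · exact (hlast a hav).le
  set x := εk⁻¹ * omegaD d ^ (-p) with hxdef
  have hx0 : x ≠ 0 := mul_ne_zero (inv_ne_zero hε) (zpow_ne_zero _ hw0)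
  set P := transferTsucc d G h Finset.univ p εk⁻¹ with hPdef
  have hPc : ∀ u, TT G h Finset.univ u * P = P * TT G h Finset.univ u := by
    intro u
    apply Commute.list_prod_right
    intro y hy
    obtain ⟨m, _, rfl⟩ := List.mem_map.1 hy
    rw [transferT_eq]
    exact TT_comm C _ _ _
  have hP : TT G h Finset.univ x * P = 0 := by
    have e := prod_formula C hd b hpow (x * omegaD d) (mul_ne_zero hx0 hw0) _ Finset.univ rfl
    have hxd : (x * omegaD d) ^ d = εk ^ (-(d : ℤ)) := by
      rw [mul_pow, hw.pow_eq_one, mul_one, hxdef, mul_pow, ← zpow_natCast (omegaD d ^ (-p)),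
        ← zpow_mul, mul_comm (-p), zpow_mul, zpow_natCast, hw.pow_eq_one, one_zpow, mul_one, zpow_neg,
        zpow_natCast, inv_pow]
    rw [hxd, hZ, zero_smul, ← pr_reverse _ (fun m n => TT_comm C _ _ _)] at e
    rw [← e, hPdef]
    obtain ⟨k, rfl⟩ : ∃ k, d = k + 1 := ⟨d - 1, by omega⟩
    have hz : ∀ i : ℕ, i ≤ k → x * omegaD (k + 1) * omegaD (k + 1) ^ (k + 1 - 1 - i)
        = εk⁻¹ * omegaD (k + 1) ^ (-(p + (i : ℤ))) := by
      intro i hi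
      have h1 := hw.pow_eq_one
      have h2 : omegaD (k + 1) * omegaD (k + 1) ^ (k + 1 - 1 - i) = omegaD (k + 1) ^ (-(i : ℤ)) := by
        rw [zpow_neg, zpow_natCast, ← mul_eq_one_iff_eq_inv₀ (pow_ne_zero _ hw0), ← pow_succ', ← pow_add,
          ← h1]
        congr 1; omega
      rw [mul_assoc, h2, hxdef, mul_assoc, ← zpow_add₀ hw0]
      congr 2; ring
    rw [List.range_succ_eq_map, List.map_cons, List.prod_cons, List.map_map, transferTsucc]
    have hlist : ∀ l : List ℕ, (do let a ← l; pure (a : ℤ)) = l.map (fun a : ℕ => (a : ℤ)) := by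
      intro l
      induction l with
      | nil => rfl
      | cons a l ih => simpa using ih
    rw [hlist, List.map_map]
    congr 1
    · rw [hz 0 (by omega)]; simp [hxdef]
    · congr 1
      apply List.map_congr_left
      intro i hi
      have hi := List.mem_range.1 hi
      simp only [Nat.add_sub_cancel] at hi
      simp only [Function.comp]
      rw [transferT_eq, hz (i + 1) (by omega)]
      congr 3
      push_cast; ring
  have hex := exchange C hd hl χ P hχcomm hχv x hP hPc
  have key := deriv_step (omegaD d) x _ (chargeQ G h Finset.univ)
    (TT G h Finset.univ x * χ * P) (TT G h Finset.univ)
    (fun u => (transferT_eq G h Finset.univ u).symm)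
    (by rw [mul_assoc, ← hPc, hP, mul_zero]) hex
  unfold paraMode
  rw [← hPdef, ← hxdef, transferT_eq, mul_smul_comm, key, smul_mul_assoc, smul_comm _ (Nk⁻¹)]
  congr 1
  rw [mul_smul, ← mul_smul_comm εk, neg_smul, ← smul_neg, ← mul_neg]
  congr 2
  unfold transferTderiv
  rw [smul_neg, Finset.smul_sum]
  congr 1
  apply Finset.sum_congr rfl
  intro k _
  rw [smul_smul]
  congr 1
  have hz1 : εk ^ (-(k : ℤ) - 1) = (εk⁻¹) ^ k * εk⁻¹ := by
    rw [zpow_sub₀ hε, zpow_neg, zpow_natCast, zpow_one, inv_pow, div_eq_mul_inv]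
  rw [hz1, hxdef, ← mul_neg, mul_pow]
  have hz2 : εk * εk⁻¹ = 1 := mul_inv_cancel₀ hε
  linear_combination (-((k : ℂ) * (-(omegaD d ^ (-p))) ^ k * (εk⁻¹) ^ k)) * hz2
end
end

section
/- Let G be an oriented indifference graph with a fixed oriented perfect elimination ordering whose last vertex is v, let (h_u)_{u∈V} be a Hamiltonian compatible with G, let χ be a simplicial mode, let ε_k be a single-particle energy, and let N_k be a nonzero complex constant. Then for all p ∈ ℤ, ψ_{p,k} = (1/N_k) · (1−ω) · ω^{−p−1} · ε_k^{−1} · h_v · χ · T_{G∖N[v]}^p(ε_k^{−1}) · T_G^{≻p}(ε_k^{−1}). -/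
noncomputable section
open scoped Classical

/-- The closed neighbourhood `N[v]` of a vertex. -/
def closedNbhd {V : Type*} [Fintype V] (G : SimpleGraph V) (v : V) : Finset V :=
  insert v (Finset.univ.filter (fun u => G.Adj v u))
section aux
variable {V : Type*} [LinearOrder V] {N : ℕ}

theorem transferT_eq_s17 (G : SimpleGraph V) (h : V → Matrix (Fin N) (Fin N) ℂ) (A : Finset V) (x : ℂ) :
    transferT G h A x =
      ∑ S ∈ A.powerset.filter (fun S => IsIndep G S), (-x) ^ S.card • hProd h S := by
  unfold transferT chargeQ
  simp only [Finset.smul_sum]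
  rw [← Finset.sum_fiberwise_of_maps_to (s := A.powerset.filter (fun S => IsIndep G S))
    (t := Finset.range (indepNum G A + 1)) (g := Finset.card)]
  · refine Finset.sum_congr rfl fun k _ => ?_
    rw [Finset.filter_filter]
    refine Finset.sum_congr rfl fun S hS => ?_
    rw [(Finset.mem_filter.1 hS).2.2]
  · intro S hS
    rw [Finset.mem_range, Nat.lt_succ_iff]
    exact Finset.le_sup (f := Finset.card) hS

theorem hProd_eq_noncomm (h : V → Matrix (Fin N) (Fin N) ℂ) (S : Finset V)
    (hc : (S : Set V).Pairwise (Function.onFun Commute h)) :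
    hProd h S = S.noncommProd h hc := by
  unfold hProd Finset.noncommProd
  have : ∀ (m : Multiset (Matrix (Fin N) (Fin N) ℂ)) (hm : Set.Pairwise {x | x ∈ m} Commute)
      (l : List (Matrix (Fin N) (Fin N) ℂ)), (l : Multiset _) = m → l.prod = m.noncommProd hm := by
    rintro m hm l rfl
    rw [Multiset.noncommProd_coe]
  apply this
  rw [← Multiset.map_coe, Finset.sort_eq]

theorem hProd_insert_s17 (h : V → Matrix (Fin N) (Fin N) ℂ) (S : Finset V) (v : V) (hv : v ∉ S)
    (hc : ((insert v S : Finset V) : Set V).Pairwise (Function.onFun Commute h)) :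
    hProd h (insert v S) = h v * hProd h S := by
  rw [hProd_eq_noncomm h _ hc, Finset.noncommProd_insert_of_notMem _ _ _ _ hv,
    hProd_eq_noncomm]

theorem hProd_move (h : V → Matrix (Fin N) (Fin N) ℂ) (S : Finset V) (X : Matrix (Fin N) (Fin N) ℂ)
    (q : V → ℂ) (hq : ∀ u ∈ S, h u * X = q u • (X * h u)) :
    hProd h S * X = (∏ u ∈ S, q u) • (X * hProd h S) := by
  have key : ∀ l : List V, (∀ u ∈ l, h u * X = q u • (X * h u)) →
      (l.map h).prod * X = (l.map q).prod • (X * (l.map h).prod) := by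
    intro l
    induction l with
    | nil => simp
    | cons a l ih =>
      intro hl
      have h1 := ih fun u hu => hl u (List.mem_cons_of_mem _ hu)
      have h2 := hl a List.mem_cons_self
      simp only [List.map_cons, List.prod_cons]
      rw [mul_assoc, h1, mul_smul_comm, ← mul_assoc, h2, smul_mul_assoc, smul_smul, mul_assoc,
        mul_comm (q a)]
  have h3 : (∏ u ∈ S, q u) = ((S.sort (· ≤ ·)).map q).prod := by
    rw [← Multiset.prod_coe, ← Multiset.map_coe, Finset.sort_eq]; rfl
  rw [h3]
  exact key _ fun u hu => hq u ((Finset.mem_sort _).1 hu)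

theorem hProd_scale (h : V → Matrix (Fin N) (Fin N) ℂ) (S : Finset V) (z : V → ℂ) :
    hProd (fun u => z u • h u) S = (∏ u ∈ S, z u) • hProd h S := by
  have key : ∀ l : List V,
      (l.map (fun u => z u • h u)).prod = (l.map z).prod • (l.map h).prod := by
    intro l
    induction l with
    | nil => simp
    | cons a l ih =>
      simp only [List.map_cons, List.prod_cons]
      rw [ih, smul_mul_smul_comm]
  have h3 : (∏ u ∈ S, z u) = ((S.sort (· ≤ ·)).map z).prod := by
    rw [← Multiset.prod_coe, ← Multiset.map_coe, Finset.sort_eq]; rfl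
  rw [h3]
  exact key _

theorem IsIndep.mono' {G : SimpleGraph V} {S T : Finset V} (hT : IsIndep G T) (hS : S ⊆ T) :
    IsIndep G S := fun u hu w hw => hT u (hS hu) w (hS hw)

theorem isIndep_insert {G : SimpleGraph V} {S : Finset V} {v : V} :
    IsIndep G (insert v S) ↔ IsIndep G S ∧ ∀ u ∈ S, ¬ G.Adj v u := by
  constructor
  · intro H
    refine ⟨H.mono' (Finset.subset_insert _ _), fun u hu hadj => ?_⟩
    exact H v (Finset.mem_insert_self _ _) u (Finset.mem_insert_of_mem hu) hadj.ne hadj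
  · rintro ⟨H, H'⟩ u hu w hw huw hadj
    rcases Finset.mem_insert.1 hu with h1 | h1
    · subst h1
      rcases Finset.mem_insert.1 hw with h2 | h2
      · exact huw h2.symm
      · exact H' w h2 hadj
    · rcases Finset.mem_insert.1 hw with h2 | h2
      · subst h2
        exact H' u h1 hadj.symm
      · exact H u h1 w h2 huw hadj

/-- independent sets of `A`, with `v ∈ A`, split according to whether they contain `v`. -/
theorem sum_indep_split {M : Type*} [AddCommMonoid M] (G : SimpleGraph V) (A : Finset V) (v : V)
    (hv : v ∈ A) (F : Finset V → M) :
    ∑ S ∈ A.powerset.filter (fun S => IsIndep G S), F S =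
      ∑ S ∈ (A.erase v).powerset.filter (fun S => IsIndep G S), F S +
      ∑ S ∈ ((A.erase v).powerset.filter (fun S => IsIndep G S)).filter
        (fun S => ∀ u ∈ S, ¬ G.Adj v u), F (insert v S) := by
  rw [← Finset.sum_filter_add_sum_filter_not _ (fun S => v ∉ S)]
  congr 1
  · refine Finset.sum_congr ?_ fun _ _ => rfl
    ext S
    simp only [Finset.mem_filter, Finset.mem_powerset, Finset.subset_erase]
    tauto
  · symm
    refine Finset.sum_bij' (fun S _ => insert v S) (fun S _ => S.erase v) ?_ ?_ ?_ ?_ ?_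
    · intro S hS
      simp only [Finset.mem_filter, Finset.mem_powerset, Finset.subset_erase] at hS ⊢
      refine ⟨⟨?_, isIndep_insert.2 ⟨hS.1.2, hS.2⟩⟩, by simp⟩
      exact Finset.insert_subset hv hS.1.1.1
    · intro S hS
      simp only [Finset.mem_filter, Finset.mem_powerset, not_not] at hS ⊢
      obtain ⟨⟨h1, h2⟩, h3⟩ := hS
      rw [← Finset.insert_erase h3, isIndep_insert] at h2
      exact ⟨⟨Finset.erase_subset_erase _ h1, h2.1⟩, h2.2⟩
    · intro S hS
      simp only [Finset.mem_filter, Finset.mem_powerset, Finset.subset_erase] at hS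
      exact Finset.erase_insert hS.1.1.2
    · intro S hS
      simp only [Finset.mem_filter, not_not] at hS
      exact Finset.insert_erase hS.2
    · intro S hS
      rfl

/-- part of the transfer operator free of neighbours of `v`. -/
def partB (G : SimpleGraph V) (h : V → Matrix (Fin N) (Fin N) ℂ) (A : Finset V) (v : V) (x : ℂ) :
    Matrix (Fin N) (Fin N) ℂ :=
  ∑ S ∈ ((A.erase v).powerset.filter (fun S => IsIndep G S)).filter
        (fun S => ∀ u ∈ S, ¬ G.Adj v u), (-x) ^ S.card • hProd h S

/-- part of the transfer operator containing a neighbour of `v`. -/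
def partC (G : SimpleGraph V) (h : V → Matrix (Fin N) (Fin N) ℂ) (A : Finset V) (v : V) (x : ℂ) :
    Matrix (Fin N) (Fin N) ℂ :=
  ∑ S ∈ ((A.erase v).powerset.filter (fun S => IsIndep G S)).filter
        (fun S => ¬ ∀ u ∈ S, ¬ G.Adj v u), (-x) ^ S.card • hProd h S

theorem transferT_rec (G : SimpleGraph V) (h : V → Matrix (Fin N) (Fin N) ℂ)
    (hcn : ∀ u w, u ≠ w → ¬ G.Adj u w → h u * h w = h w * h u) (A : Finset V) (v : V)
    (hv : v ∈ A) (x : ℂ) :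
    transferT G h A x = transferT G h (A.erase v) x - x • (h v * partB G h A v x) := by
  rw [transferT_eq_s17, transferT_eq_s17, sum_indep_split G A v hv, sub_eq_add_neg]
  congr 1
  unfold partB
  rw [Finset.mul_sum, Finset.smul_sum, ← Finset.sum_neg_distrib]
  refine Finset.sum_congr rfl fun S hS => ?_
  simp only [Finset.mem_filter, Finset.mem_powerset, Finset.subset_erase] at hS
  rw [hProd_insert_s17 h S v hS.1.1.2, Finset.card_insert_of_notMem hS.1.1.2, mul_smul_comm, smul_smul,
    ← neg_smul, pow_succ]
  · congr 1; ring
  · intro u hu w hw huw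
    have := isIndep_insert.2 ⟨hS.1.2, hS.2⟩
    exact hcn u w huw (this u hu w hw huw)

theorem partB_eq [Fintype V] (G : SimpleGraph V) (h : V → Matrix (Fin N) (Fin N) ℂ) (v : V) (x : ℂ) :
    partB G h Finset.univ v x = transferT G h (Finset.univ \ closedNbhd G v) x := by
  rw [transferT_eq_s17]
  unfold partB
  refine Finset.sum_congr ?_ fun _ _ => rfl
  ext S
  simp only [Finset.mem_filter, Finset.mem_powerset, Finset.subset_iff, closedNbhd,
    Finset.mem_sdiff, Finset.mem_erase, Finset.mem_univ, true_and, and_true, Finset.mem_insert]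
  constructor
  · rintro ⟨⟨h1, h2⟩, h3⟩
    exact ⟨fun u hu => by rintro (h | h); exacts [h1 hu h, h3 u hu h], h2⟩
  · rintro ⟨h1, h2⟩
    exact ⟨⟨fun u hu h => h1 hu (Or.inl h), h2⟩, fun u hu h => h1 hu (Or.inr h)⟩

/-- An independent set meets the clique of neighbours of `v` in at most one element. -/
theorem prod_nbr (G : SimpleGraph V) (A S : Finset V) (v : V)
    (hcl : ∀ u ∈ A, ∀ w ∈ A, G.Adj v u → G.Adj v w → u ≠ w → G.Adj u w)
    (hS : S ⊆ A) (hI : IsIndep G S) (t : ℂ) :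
    ∏ u ∈ S, (if G.Adj v u then t else 1) = if ∀ u ∈ S, ¬ G.Adj v u then 1 else t := by
  split_ifs with hn
  · exact Finset.prod_eq_one fun u hu => if_neg (hn u hu)
  · push Not at hn
    obtain ⟨u, hu, hadj⟩ := hn
    rw [Finset.prod_eq_single_of_mem u hu, if_pos hadj]
    intro w hw hne
    refine if_neg fun hadj' => ?_
    exact hI w hw u hu hne (hcl w (hS hw) u (hS hu) hadj' hadj hne)

theorem transferT_scaled (G : SimpleGraph V) (h : V → Matrix (Fin N) (Fin N) ℂ)
    (A : Finset V) (v : V)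
    (hcl : ∀ u ∈ A, ∀ w ∈ A, G.Adj v u → G.Adj v w → u ≠ w → G.Adj u w) (x t : ℂ) :
    transferT G (fun u => (if G.Adj v u then t else 1) • h u) (A.erase v) x =
      partB G h A v x + t • partC G h A v x := by
  rw [transferT_eq_s17, ← Finset.sum_filter_add_sum_filter_not _ (fun S => ∀ u ∈ S, ¬ G.Adj v u)]
  unfold partB partC
  rw [Finset.smul_sum]
  congr 1
  · refine Finset.sum_congr rfl fun S hS => ?_
    simp only [Finset.mem_filter, Finset.mem_powerset, Finset.subset_erase] at hS
    rw [hProd_scale, prod_nbr G A S v hcl hS.1.1.1 hS.1.2, if_pos hS.2, one_smul]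
  · refine Finset.sum_congr rfl fun S hS => ?_
    simp only [Finset.mem_filter, Finset.mem_powerset, Finset.subset_erase] at hS
    rw [hProd_scale, prod_nbr G A S v hcl hS.1.1.1 hS.1.2, if_neg hS.2, smul_comm]

theorem transferT_BC (G : SimpleGraph V) (h : V → Matrix (Fin N) (Fin N) ℂ)
    (A : Finset V) (v : V) (x : ℂ) :
    transferT G h (A.erase v) x = partB G h A v x + partC G h A v x := by
  rw [transferT_eq_s17, ← Finset.sum_filter_add_sum_filter_not _ (fun S => ∀ u ∈ S, ¬ G.Adj v u)]
  rfl

theorem partB_comm (G : SimpleGraph V) (h : V → Matrix (Fin N) (Fin N) ℂ)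
    (hcn : ∀ u w, u ≠ w → ¬ G.Adj u w → h u * h w = h w * h u) (A : Finset V) (v : V) (x : ℂ) :
    partB G h A v x * h v = h v * partB G h A v x := by
  unfold partB
  rw [Finset.mul_sum, Finset.sum_mul]
  refine Finset.sum_congr rfl fun S hS => ?_
  simp only [Finset.mem_filter, Finset.mem_powerset, Finset.subset_erase] at hS
  rw [smul_mul_assoc, mul_smul_comm, hProd_move h S (h v) (fun _ => 1)]
  · simp
  · intro u hu
    rw [one_smul]
    exact hcn u v (fun e => hS.1.1.2 (e ▸ hu)) fun ha => hS.2 u hu ha.symm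

theorem partC_comm (G : SimpleGraph V) (h : V → Matrix (Fin N) (Fin N) ℂ) (ω : ℂ)
    (hcn : ∀ u w, u ≠ w → ¬ G.Adj u w → h u * h w = h w * h u) (A : Finset V) (v : V)
    (hcl : ∀ u ∈ A, ∀ w ∈ A, G.Adj v u → G.Adj v w → u ≠ w → G.Adj u w)
    (hcd : ∀ u ∈ A, G.Adj v u → h u * h v = ω • (h v * h u)) (x : ℂ) :
    partC G h A v x * h v = ω • (h v * partC G h A v x) := by
  unfold partC
  rw [Finset.mul_sum, Finset.sum_mul, Finset.smul_sum]
  refine Finset.sum_congr rfl fun S hS => ?_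
  simp only [Finset.mem_filter, Finset.mem_powerset, Finset.subset_erase] at hS
  rw [smul_mul_assoc, mul_smul_comm, hProd_move h S (h v) (fun u => if G.Adj v u then ω else 1),
    prod_nbr G A S v hcl hS.1.1.1 hS.1.2, if_neg hS.2, smul_comm]
  intro u hu
  split_ifs with ha
  · exact hcd u (hS.1.1.1 hu) ha
  · rw [one_smul]
    exact hcn u v (fun e => hS.1.1.2 (e ▸ hu)) fun h' => ha h'.symm

theorem indepPoly_split (G : SimpleGraph V) (w : V → ℂ) (A : Finset V) (v : V) (hv : v ∈ A)
    (hcl : ∀ u ∈ A, ∀ w ∈ A, G.Adj v u → G.Adj v w → u ≠ w → G.Adj u w) (x : ℂ) :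
    ∃ zb zc : ℂ, indepPoly G w A x = zb + zc + x * w v * zb ∧
      ∀ t : ℂ, indepPoly G (fun u => (if G.Adj v u then t else 1) * w u) (A.erase v) x
        = zb + t * zc := by
  refine ⟨∑ S ∈ ((A.erase v).powerset.filter (fun S => IsIndep G S)).filter
        (fun S => ∀ u ∈ S, ¬ G.Adj v u), ∏ u ∈ S, (x * w u),
    ∑ S ∈ ((A.erase v).powerset.filter (fun S => IsIndep G S)).filter
        (fun S => ¬ ∀ u ∈ S, ¬ G.Adj v u), ∏ u ∈ S, (x * w u), ?_, ?_⟩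
  · unfold indepPoly
    rw [sum_indep_split G A v hv, Finset.sum_filter_add_sum_filter_not, Finset.mul_sum]
    congr 1
    refine Finset.sum_congr rfl fun S hS => ?_
    simp only [Finset.mem_filter, Finset.mem_powerset, Finset.subset_erase] at hS
    rw [Finset.prod_insert hS.1.1.2]
  · intro t
    unfold indepPoly
    rw [← Finset.sum_filter_add_sum_filter_not _ (fun S => ∀ u ∈ S, ¬ G.Adj v u), Finset.mul_sum]
    congr 1
    · refine Finset.sum_congr rfl fun S hS => ?_
      simp only [Finset.mem_filter, Finset.mem_powerset, Finset.subset_erase] at hS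
      simp only [mul_left_comm x]
      rw [Finset.prod_mul_distrib, prod_nbr G A S v hcl hS.1.1.1 hS.1.2, if_pos hS.2, one_mul]
    · refine Finset.sum_congr rfl fun S hS => ?_
      simp only [Finset.mem_filter, Finset.mem_powerset, Finset.subset_erase] at hS
      simp only [mul_left_comm x]
      rw [Finset.prod_mul_distrib, prod_nbr G A S v hcl hS.1.1.1 hS.1.2, if_neg hS.2]

end aux

section alg
variable {N : ℕ}

/-- `k`-th coefficient of `∏_{m<n} (B m + t C m)`. -/
def coefR (B C : ℕ → Matrix (Fin N) (Fin N) ℂ) : ℕ → ℕ → Matrix (Fin N) (Fin N) ℂ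
  | 0, 0 => 1
  | 0, _ + 1 => 0
  | n + 1, 0 => coefR B C n 0 * B n
  | n + 1, k + 1 => coefR B C n (k + 1) * B n + coefR B C n k * C n

/-- `∏_{r<j} (1 - x q^r h)`. -/
def polyG (h : Matrix (Fin N) (Fin N) ℂ) (x q : ℂ) : ℕ → Matrix (Fin N) (Fin N) ℂ
  | 0 => 1
  | j + 1 => polyG h x q j * (1 - (x * q ^ j) • h)

theorem coefR_zero (B C : ℕ → Matrix (Fin N) (Fin N) ℂ) (n k : ℕ) (hk : n < k) :
    coefR B C n k = 0 := by
  induction n generalizing k with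
  | zero => cases k with
    | zero => omega
    | succ k => rfl
  | succ n ih => cases k with
    | zero => omega
    | succ k => simp [coefR, ih (k+1) (by omega), ih k (by omega)]

theorem prod_range_succ_list (F : ℕ → Matrix (Fin N) (Fin N) ℂ) (n : ℕ) :
    ((List.range (n+1)).map F).prod = ((List.range n).map F).prod * F n := by
  simp [List.range_succ]

theorem sum_rec (B C : ℕ → Matrix (Fin N) (Fin N) ℂ) (n : ℕ)
    (g : ℕ → Matrix (Fin N) (Fin N) ℂ) :
    ∑ k ∈ Finset.range (n + 2), g k * coefR B C (n + 1) k =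
      ∑ k ∈ Finset.range (n + 1),
        (g k * (coefR B C n k * B n) + g (k + 1) * (coefR B C n k * C n)) := by
  rw [Finset.sum_range_succ', Finset.sum_add_distrib]
  simp only [coefR, mul_add]
  rw [Finset.sum_add_distrib, add_right_comm]
  congr 1
  rw [Finset.sum_range_succ' (fun k => g k * (coefR B C n k * B n)),
    Finset.sum_range_succ, coefR_zero B C n (n+1) (by omega)]
  simp

theorem coefR_spec (B C : ℕ → Matrix (Fin N) (Fin N) ℂ) (t : ℂ) (n : ℕ) :
    ((List.range n).map (fun m => B m + t • C m)).prod =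
      ∑ k ∈ Finset.range (n + 1), t ^ k • coefR B C n k := by
  induction n with
  | zero => simp [coefR]
  | succ n ih =>
    rw [prod_range_succ_list, ih]
    have := sum_rec B C n (fun k => t ^ k • 1)
    simp only [smul_mul_assoc, one_mul] at this
    rw [this, Finset.sum_mul]
    refine Finset.sum_congr rfl fun k _ => ?_
    rw [mul_add, smul_mul_assoc, mul_smul_comm, smul_mul_assoc, smul_smul, pow_succ, mul_comm t]

theorem coefR_comm (B C : ℕ → Matrix (Fin N) (Fin N) ℂ) (h : Matrix (Fin N) (Fin N) ℂ) (ω : ℂ)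
    (hB : ∀ m, B m * h = h * B m) (hC : ∀ m, C m * h = ω • (h * C m)) (n k : ℕ) :
    coefR B C n k * h = ω ^ k • (h * coefR B C n k) := by
  induction n generalizing k with
  | zero => cases k <;> simp [coefR]
  | succ n ih =>
    have e1 : ∀ k, coefR B C n k * B n * h = ω ^ k • (h * (coefR B C n k * B n)) := by
      intro k
      rw [mul_assoc, hB, ← mul_assoc, ih, smul_mul_assoc, mul_assoc]
    cases k with
    | zero => simpa [coefR] using e1 0
    | succ k =>
      simp only [coefR]
      have e2 : coefR B C n k * C n * h = ω ^ (k + 1) • (h * (coefR B C n k * C n)) := by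
        rw [mul_assoc, hC, mul_smul_comm, ← mul_assoc, ih, smul_mul_assoc, smul_smul, mul_assoc,
          pow_succ']
      rw [add_mul, e1, e2, mul_add, smul_add]

theorem prod_main (B C : ℕ → Matrix (Fin N) (Fin N) ℂ) (h : Matrix (Fin N) (Fin N) ℂ) (ω x : ℂ)
    (hω : ω ≠ 0)
    (hB : ∀ m, B m * h = h * B m) (hC : ∀ m, C m * h = ω • (h * C m)) (n : ℕ) :
    ((List.range n).map (fun m => B m + C m - (x * ω⁻¹ ^ m) • (h * B m))).prod =
      ∑ k ∈ Finset.range (n + 1), polyG h x ω⁻¹ (n - k) * coefR B C n k := by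
  induction n with
  | zero => simp [coefR, polyG]
  | succ n ih =>
    rw [prod_range_succ_list, ih, sum_rec B C n (fun k => polyG h x ω⁻¹ (n + 1 - k)),
      Finset.sum_mul]
    refine Finset.sum_congr rfl fun k hk => ?_
    have hk' : k ≤ n := by simpa [Nat.lt_succ_iff] using hk
    rw [show n + 1 - k = (n - k) + 1 by omega, show n + 1 - (k + 1) = n - k by omega]
    simp only [polyG]
    have e : ω⁻¹ ^ (n - k) = ω⁻¹ ^ n * ω ^ k := by
      have : ω⁻¹ ^ n = ω⁻¹ ^ (n - k) * ω⁻¹ ^ k := by rw [← pow_add]; congr 1; omega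
      rw [this, mul_assoc, ← mul_pow, inv_mul_cancel₀ hω, one_pow, mul_one]
    rw [e]
    have hR := coefR_comm B C h ω hB hC n k
    have e2 : coefR B C n k * (h * B n) = ω ^ k • (h * (coefR B C n k * B n)) := by
      rw [← mul_assoc, hR, smul_mul_assoc, mul_assoc]
    simp only [mul_sub, mul_add, sub_mul, mul_one, mul_smul_comm, smul_mul_assoc, mul_assoc, e2,
      smul_smul]
    abel

theorem polyG_eq (h : Matrix (Fin N) (Fin N) ℂ) (x ω : ℂ) (d : ℕ) (hd : 0 < d)
    (hω : IsPrimitiveRoot ω d) : polyG h x ω d = 1 - (x ^ d) • h ^ d := by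
  have h1 : ∀ j, polyG h x ω j = Polynomial.aeval h
      (∏ r ∈ Finset.range j, (1 - Polynomial.C (ω ^ r) * (Polynomial.C x * Polynomial.X))) := by
    intro j
    induction j with
    | zero => simp [polyG]
    | succ j ih =>
      rw [Finset.prod_range_succ, map_mul, ← ih]
      simp only [polyG]
      congr 1
      rw [← mul_assoc, ← Polynomial.C_mul, map_sub, map_one, ← Polynomial.smul_eq_C_mul, map_smul,
        Polynomial.aeval_X, mul_comm x]
  have hp : IsPrimitiveRoot (Polynomial.C ω) d :=
    hω.map_of_injective Polynomial.C_injective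
  have h2 := hp.pow_sub_pow_eq_prod_sub_mul 1 (Polynomial.C x * Polynomial.X) hd
  have h3 : Polynomial.nthRootsFinset d (1 : Polynomial ℂ) =
      (Finset.range d).image (fun r => (Polynomial.C ω) ^ r) := by
    symm
    apply Finset.eq_of_subset_of_card_le
    · intro z hz
      obtain ⟨r, _, rfl⟩ := Finset.mem_image.1 hz
      rw [Polynomial.mem_nthRootsFinset hd, ← pow_mul, mul_comm, pow_mul, hp.pow_eq_one, one_pow]
    · rw [hp.card_nthRootsFinset, Finset.card_image_of_injOn, Finset.card_range]
      intro a ha b hb hab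
      exact hp.pow_inj (by simpa using ha) (by simpa using hb) hab
  rw [h3, Finset.prod_image] at h2
  · rw [h1]
    simp only [Polynomial.C_pow]
    rw [← h2]
    rw [one_pow, mul_pow, ← Polynomial.C_pow, map_sub, map_one, ← Polynomial.smul_eq_C_mul,
      map_smul, map_pow, Polynomial.aeval_X]
  · intro a ha b hb hab
    exact hp.pow_inj (by simpa using ha) (by simpa using hb) hab

theorem coef_zero (n : ℕ) (M : ℕ → Matrix (Fin N) (Fin N) ℂ)
    (hM : ∀ t : ℂ, ∑ k ∈ Finset.range n, t ^ k • M k = 0) (k : ℕ) (hk : k < n) : M k = 0 := by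
  ext i j
  have : (∑ k ∈ Finset.range n, Polynomial.C (M k i j) * Polynomial.X ^ k) = 0 := by
    apply Polynomial.funext
    intro t
    have := congrFun (congrFun (hM t) i) j
    simp only [Matrix.sum_apply, Matrix.smul_apply, smul_eq_mul, Matrix.zero_apply] at this
    rw [Polynomial.eval_finsetSum, Polynomial.eval_zero, ← this]
    refine Finset.sum_congr rfl fun k _ => ?_
    rw [Polynomial.eval_mul, Polynomial.eval_C, Polynomial.eval_pow, Polynomial.eval_X, mul_comm]
  have := congrArg (fun p => Polynomial.coeff p k) this
  simpa [Polynomial.finsetSum_coeff, Polynomial.coeff_C_mul, Polynomial.coeff_X_pow, hk]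
    using this

end alg

theorem prod_transfer {V : Type*} [LinearOrder V] {N : ℕ} (d : ℕ) (hd : 0 < d)
    (ω : ℂ) (hω : IsPrimitiveRoot ω d) (G : SimpleGraph V) (f : V → ℕ)
    (hinj : Function.Injective f)
    (hcl : ∀ v u w, G.Adj u v → G.Adj w v → f u < f v → f w < f v → u ≠ w → G.Adj u w) (x : ℂ)
    (n : ℕ) :
    ∀ (A : Finset V) (_ : A.card = n) (h : V → Matrix (Fin N) (Fin N) ℂ) (c : V → ℂ)
      (_ : ∀ w, h w ^ d = c w • (1 : Matrix (Fin N) (Fin N) ℂ))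
      (_ : ∀ u w, G.Adj u w → f u < f w → h u * h w = ω • (h w * h u))
      (_ : ∀ u w, u ≠ w → ¬ G.Adj u w → h u * h w = h w * h u),
      ((List.range d).map (fun m => transferT G h A (x * ω⁻¹ ^ m))).prod =
        indepPoly G c A (-x ^ d) • (1 : Matrix (Fin N) (Fin N) ℂ) := by
  have hω0 : ω ≠ 0 := hω.ne_zero hd.ne'
  induction n with
  | zero =>
    intro A hA h c _ _ _
    rw [Finset.card_eq_zero] at hA
    subst hA
    have hI : IsIndep G ∅ := by intro u hu; simp at hu
    have h1 : ∀ y, transferT G h ∅ y = 1 := by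
      intro y
      rw [transferT_eq_s17]
      simp [Finset.filter_singleton, hI, hProd]
    simp [h1, indepPoly, Finset.filter_singleton, hI]
  | succ n ih =>
    intro A hA h c hpow hcd hcn
    obtain ⟨v, hv, hmax⟩ := Finset.exists_max_image A f (Finset.card_pos.1 (by omega))
    have hlt : ∀ u ∈ A, G.Adj v u → f u < f v := fun u hu ha =>
      lt_of_le_of_ne (hmax u hu) fun e => ha.ne (hinj e).symm
    have hclA : ∀ u ∈ A, ∀ w ∈ A, G.Adj v u → G.Adj v w → u ≠ w → G.Adj u w :=
      fun u hu w hw ha hb => hcl v u w ha.symm hb.symm (hlt u hu ha) (hlt w hw hb)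
    have hcdA : ∀ u ∈ A, G.Adj v u → h u * h v = ω • (h v * h u) :=
      fun u hu ha => hcd u v ha.symm (hlt u hu ha)
    obtain ⟨zb, zc, hz, hzt⟩ := indepPoly_split G c A v hv hclA (-x ^ d)
    set B := fun m : ℕ => partB G h A v (x * ω⁻¹ ^ m) with hBdef
    set C := fun m : ℕ => partC G h A v (x * ω⁻¹ ^ m) with hCdef
    have hR : ∀ t : ℂ, ∑ k ∈ Finset.range (d + 1), t ^ k • coefR B C d k =
        (zb + t ^ d * zc) • (1 : Matrix (Fin N) (Fin N) ℂ) := by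
      intro t
      rw [← coefR_spec, ← hzt]
      have := ih (A.erase v) (by rw [Finset.card_erase_of_mem hv]; omega)
        (fun u => (if G.Adj v u then t else 1) • h u)
        (fun u => (if G.Adj v u then t ^ d else 1) * c u) ?_ ?_ ?_
      · rw [← this]
        simp only [transferT_scaled G h A v hclA, hBdef, hCdef]
      · intro w
        rw [smul_pow, hpow, smul_smul]
        congr 2
        split_ifs <;> simp
      · intro u w ha hf
        rw [smul_mul_smul_comm, smul_mul_smul_comm, hcd u w ha hf, smul_comm, mul_comm]
      · intro u w hne ha
        rw [smul_mul_smul_comm, smul_mul_smul_comm, hcn u w hne ha, mul_comm]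
    have hcoef : ∀ k < d + 1, coefR B C d k =
        ((if k = 0 then zb else 0) + (if k = d then zc else 0)) •
          (1 : Matrix (Fin N) (Fin N) ℂ) := by
      intro k hk
      rw [← sub_eq_zero]
      refine coef_zero (d + 1) (fun k => coefR B C d k -
        ((if k = 0 then zb else 0) + (if k = d then zc else 0)) •
          (1 : Matrix (Fin N) (Fin N) ℂ)) ?_ k hk
      intro t
      simp only [smul_sub, Finset.sum_sub_distrib, hR t, smul_smul, ← Finset.sum_smul, mul_add,
        Finset.sum_add_distrib, mul_ite, mul_zero, Finset.sum_ite_eq', Finset.mem_range]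
      simp
    have hT : ∀ m : ℕ, transferT G h A (x * ω⁻¹ ^ m) =
        B m + C m - (x * ω⁻¹ ^ m) • (h v * B m) := by
      intro m
      rw [transferT_rec G h hcn A v hv, transferT_BC]
    simp only [hT]
    rw [prod_main B C (h v) ω x hω0 (fun m => partB_comm G h hcn A v _)
      (fun m => partC_comm G h ω hcn A v hclA hcdA _)]
    have : ∀ k ∈ Finset.range (d + 1), polyG (h v) x ω⁻¹ (d - k) * coefR B C d k =
        (if k = 0 then zb • polyG (h v) x ω⁻¹ (d - k) else 0) +
        (if k = d then zc • polyG (h v) x ω⁻¹ (d - k) else 0) := by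
      intro k hk
      rw [hcoef k (Finset.mem_range.1 hk), mul_smul_comm, mul_one, add_smul, ite_smul, ite_smul,
        zero_smul]
    rw [Finset.sum_congr rfl this, Finset.sum_add_distrib, Finset.sum_ite_eq', Finset.sum_ite_eq',
      if_pos (by simp), if_pos (by simp), Nat.sub_zero, Nat.sub_self,
      polyG_eq _ _ _ d hd hω.inv, hpow, hz]
    simp only [polyG]
    module

/-- vertex-deletion expression for a parafermionic mode. -/
theorem paraMode_vertex_deletion
    {V : Type*} [Fintype V] [LinearOrder V] {N : ℕ}
    (d : ℕ) (hd : 2 ≤ d)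
    (G : SimpleGraph V) (dir : V → V → Prop)
    (hdir : ∀ u v, dir u v → G.Adj u v)
    (hdir' : ∀ u v, G.Adj u v → (dir u v ↔ ¬ dir v u))
    (hdip : DipathOriented G dir)
    (f : V → ℕ) (hopeo : IsOPEO G dir f)
    (v : V) (hlast : ∀ u, u ≠ v → f u < f v)
    (h : V → Matrix (Fin N) (Fin N) ℂ) (b : V → ℝ)
    (hb : ∀ w, b w ≠ 0)
    (hpow : ∀ w, h w ^ d = ((b w : ℂ) ^ d) • (1 : Matrix (Fin N) (Fin N) ℂ))
    (hcd : ∀ u w, dir u w → h u * h w = omegaD d • (h w * h u))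
    (hcn : ∀ u w, u ≠ w → ¬ G.Adj u w → h u * h w = h w * h u)
    (χ : Matrix (Fin N) (Fin N) ℂ) (hχ : IsUnit χ)
    (hχcomm : ∀ u, u ≠ v → χ * h u = h u * χ)
    (hχv : h v * χ = omegaD d • (χ * h v))
    (εk : ℂ) (hε : εk ≠ 0)
    (hZ : indepPoly G (fun w => (b w : ℂ) ^ d) Finset.univ (-(εk ^ (-(d : ℤ)))) = 0)
    (Nk : ℂ) (hN : Nk ≠ 0) :
    ∀ p : ℤ,
      paraMode d G h χ εk Nk p =
        (Nk⁻¹ * (1 - omegaD d) * omegaD d ^ (-p - 1) * εk⁻¹) •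
          (h v * χ *
            transferT G h (Finset.univ \ closedNbhd G v) (εk⁻¹ * omegaD d ^ (-p)) *
            transferTsucc d G h Finset.univ p εk⁻¹) := by
  intro p
  have hprim : IsPrimitiveRoot (omegaD d) d := Complex.isPrimitiveRoot_exp d (by omega)
  have hω0 : omegaD d ≠ 0 := hprim.ne_zero (by omega)
  obtain ⟨hinj, hcl, hfd⟩ := hopeo
  have hcd' : ∀ u w, G.Adj u w → f u < f w → h u * h w = omegaD d • (h w * h u) := by
    intro u w ha hf
    refine hcd u w ((hdir' u w ha).2 fun hwu => ?_)
    exact absurd (hfd w u hwu) (by omega)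
  set x : ℂ := εk⁻¹ * omegaD d ^ (-p) with hx
  have hprod := prod_transfer d (by omega) (omegaD d) hprim G f hinj hcl x _ Finset.univ rfl h
    (fun w => (b w : ℂ) ^ d) hpow hcd' hcn
  have hxd : x ^ d = εk ^ (-(d : ℤ)) := by
    have h1 : (omegaD d ^ (-p)) ^ d = 1 := by
      rw [← zpow_natCast, zpow_comm, zpow_natCast, hprim.pow_eq_one, one_zpow]
    rw [hx, mul_pow, h1, mul_one, zpow_neg, zpow_natCast, inv_pow]
  rw [hxd, hZ, zero_smul] at hprod
  have hsplit : ((List.range d).map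
      (fun m => transferT G h Finset.univ (x * (omegaD d)⁻¹ ^ m))).prod =
      transferT G h Finset.univ x * transferTsucc d G h Finset.univ p εk⁻¹ := by
    obtain ⟨e, rfl⟩ : ∃ e, d = e + 1 := ⟨d - 1, by omega⟩
    rw [List.range_succ_eq_map, List.map_cons, List.prod_cons, List.map_map]
    unfold transferTsucc
    rw [pow_zero, mul_one, Nat.add_sub_cancel]
    simp only [bind_pure_comp, List.map_eq_map, List.map_map]
    congr 3
    funext m
    simp only [Function.comp]
    congr 1
    rw [hx, mul_assoc, inv_pow, ← zpow_natCast, ← zpow_neg, ← zpow_add₀ hω0]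
    congr 2
    push_cast
    ring
  rw [hsplit] at hprod
  -- commute `T` past `χ`
  have hχT : ∀ S : Finset V, v ∉ S → hProd h S * χ = χ * hProd h S := by
    intro S hS
    rw [hProd_move h S χ (fun _ => 1)]
    · simp
    · intro u hu
      rw [one_smul, hχcomm u fun e => hS (e ▸ hu)]
  have hχA : transferT G h (Finset.univ.erase v) x * χ =
      χ * transferT G h (Finset.univ.erase v) x := by
    rw [transferT_eq_s17, Finset.mul_sum, Finset.sum_mul]
    refine Finset.sum_congr rfl fun S hS => ?_
    simp only [Finset.mem_filter, Finset.mem_powerset, Finset.subset_erase] at hS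
    rw [smul_mul_assoc, mul_smul_comm, hχT S hS.1.2]
  have hχB : partB G h Finset.univ v x * χ = χ * partB G h Finset.univ v x := by
    unfold partB
    rw [Finset.mul_sum, Finset.sum_mul]
    refine Finset.sum_congr rfl fun S hS => ?_
    simp only [Finset.mem_filter, Finset.mem_powerset, Finset.subset_erase] at hS
    rw [smul_mul_assoc, mul_smul_comm, hχT S hS.1.1.2]
  have hrec := transferT_rec G h hcn Finset.univ v (Finset.mem_univ v) x
  have hkey : transferT G h Finset.univ x * χ = χ * transferT G h Finset.univ x +
      (x * ((omegaD d)⁻¹ - 1)) • (h v * χ * partB G h Finset.univ v x) := by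
    have hv' : χ * h v = (omegaD d)⁻¹ • (h v * χ) := by
      rw [hχv, smul_smul, inv_mul_cancel₀ hω0, one_smul]
    rw [hrec, sub_mul, mul_sub, hχA, smul_mul_assoc, mul_smul_comm, mul_assoc, hχB, ← mul_assoc,
      ← mul_assoc, hv', smul_mul_assoc]
    module
  unfold paraMode
  rw [hkey, add_mul, mul_assoc χ, hprod, mul_zero, zero_add, smul_mul_assoc, smul_smul, partB_eq]
  congr 1
  rw [hx, zpow_sub₀ hω0, zpow_one]
  field_simp
end
end
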